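/- Let Ω ⊂ ℝ² be a smooth bounded strictly star-shaped domain, g : ∂Ω → Γ smooth of degree d, and let u_ε solve Δu_ε = ε⁻²∇W(u_ε) in Ω with u_ε = g on ∂Ω. Then there is a constant C independent of ε such that ∫_Ω |∇(dist(u_ε,Γ))|² ≤ C for all ε > 0. In particular, in the Ginzburg–Landau case W(u) = (1−|u|²)²/4 (where Γ = S¹ and dist(u,Γ) = |1−|u||), one has ∫_Ω |∇|u_ε||² ≤ C for all ε > 0. -/

import Mathlib

open Complex Metric MeasureTheory Filter Set Topology Bornology

noncomputable section

/-- The Laplacian of a map `u : ℂ → ℂ`, viewing `ℂ ≅ ℝ²`. -/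
def lapC (u : ℂ → ℂ) (x : ℂ) : ℂ :=
  fderiv ℝ (fun y => fderiv ℝ u y 1) x 1 +
    fderiv ℝ (fun y => fderiv ℝ u y Complex.I) x Complex.I

/-- The Laplacian of a function `h : ℂ → ℝ`. -/
def lapR (h : ℂ → ℝ) (x : ℂ) : ℝ :=
  fderiv ℝ (fun y => fderiv ℝ h y 1) x 1 +
    fderiv ℝ (fun y => fderiv ℝ h y Complex.I) x Complex.I

/-- `|∇u|²` for `u : ℂ → ℂ`. -/
def gradSq (u : ℂ → ℂ) (x : ℂ) : ℝ :=
  ‖fderiv ℝ u x 1‖ ^ 2 + ‖fderiv ℝ u x Complex.I‖ ^ 2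

/-- The gradient `∇W` of a potential `W : ℂ → ℝ`, as a point of `ℂ ≅ ℝ²`. -/
def gradW (W : ℂ → ℝ) (x : ℂ) : ℂ :=
  (fderiv ℝ W x 1 : ℂ) + (fderiv ℝ W x Complex.I : ℂ) * Complex.I

/-- The Ginzburg–Landau type energy `E_ε(u) = ∫_Ω [½|∇u|² + W(u)/ε²]`. -/
def energy (W : ℂ → ℝ) (Ω : Set ℂ) (ε : ℝ) (u : ℂ → ℂ) : ℝ :=
  ∫ x in Ω, ((1 / 2) * gradSq u x + W (u x) / ε ^ 2)

/-- `Γ` is a smooth simple closed curve of length `2π`, with (`2π`-periodic) arclength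
parametrization `τ` (so that the point `τ(e^{is})` of the paper is `τ s` here). -/
structure ArcParam (Γ : Set ℂ) (τ : ℝ → ℂ) : Prop where
  smooth : ContDiff ℝ (⊤ : ℕ∞) τ
  periodic : Function.Periodic τ (2 * Real.pi)
  arclength : ∀ s, ‖deriv τ s‖ = 1
  inj : ∀ s t : ℝ, τ s = τ t → ∃ k : ℤ, s - t = 2 * Real.pi * k
  srange : Set.range τ = Γ

/-- The hypotheses (h1)–(h5) on the potential `W`: smooth, nonnegative, vanishing exactly
on `Γ`, non-degenerate near `Γ`, and radially coercive outside `B_{R₀} ⊇ Γ`. -/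
structure PotentialHyp (Γ : Set ℂ) (W : ℂ → ℝ) (R₀ : ℝ) : Prop where
  smooth : ContDiff ℝ (⊤ : ℕ∞) W
  nonneg : ∀ z, 0 ≤ W z
  zeros : W ⁻¹' {0} = Γ
  nondeg : ∃ μ > 0, ∃ δ > 0, ∀ z : ℂ,
    Metric.infDist z Γ < δ → μ * Metric.infDist z Γ ^ 2 ≤ W z
  R0_large : ∀ z ∈ Γ, ‖z‖ < R₀
  coercive : ∀ z : ℂ, R₀ < ‖z‖ →
    0 ≤ (gradW W z).re * z.re + (gradW W z).im * z.im

/-- `u` is a (globally smooth) solution of `Δu = ε⁻² ∇W(u)` in `Ω`. -/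
def SolvesGL (W : ℂ → ℝ) (Ω : Set ℂ) (ε : ℝ) (u : ℂ → ℂ) : Prop :=
  ContDiff ℝ (⊤ : ℕ∞) u ∧ ∀ x ∈ Ω, lapC u x = (ε ^ 2)⁻¹ • gradW W (u x)

/-- The decomposition `u = τ(e^{iφ}) + t·n⃗(τ(e^{iφ}))` on the set `s`, where `t` is the
signed distance of `u` to `Γ` and `φ` is a (global) phase; the unit normal to `Γ` at `τ s`
is `i·τ'(s)`. -/
def PhaseDecomp (Γ : Set ℂ) (τ : ℝ → ℂ) (s : Set ℂ) (u : ℂ → ℂ) (t φ : ℂ → ℝ) : Prop :=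
  ContinuousOn t s ∧ ContinuousOn φ s ∧
    ∀ x ∈ s, u x = τ (φ x) + (t x : ℂ) * (Complex.I * deriv τ (φ x)) ∧
      |t x| = Metric.infDist (u x) Γ

/-- `γ` is an `L`-periodic arclength parametrization of the (smooth) boundary of `Ω`. -/
structure BoundaryParam (Ω : Set ℂ) (γ : ℝ → ℂ) (L : ℝ) : Prop where
  Lpos : 0 < L
  smooth : ContDiff ℝ (⊤ : ℕ∞) γ
  periodic : Function.Periodic γ L
  arclength : ∀ s, ‖deriv γ s‖ = 1
  inj : ∀ s t : ℝ, γ s = γ t → ∃ k : ℤ, s - t = L * k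
  srange : Set.range γ = frontier Ω

/-- `n` is the outward unit normal field along the boundary parametrization `γ` of `Ω`. -/
structure OutwardNormal (Ω : Set ℂ) (γ : ℝ → ℂ) (n : ℝ → ℂ) : Prop where
  unit : ∀ s, ‖n s‖ = 1
  orth : ∀ s, (n s).re * (deriv γ s).re + (n s).im * (deriv γ s).im = 0
  outward : ∀ s, ∀ᶠ r in nhdsWithin (0 : ℝ) (Set.Ioi (0 : ℝ)), γ s + Complex.ofReal r * n s ∉ closure Ω

/-- The maximum principle for the phase (Proposition 2.2) holds with constants `δ₁`, `m`:
for every critical point `u` of `E_ε` on a bounded simply connected domain `ω`, continuous on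
`closure ω` and with `dist(u,Γ) ≤ δ₁` there, the functions `φ ∓ m t²/2` attain their
min/max on `∂ω`. -/
def MaxPrinciple (Γ : Set ℂ) (τ : ℝ → ℂ) (W : ℂ → ℝ) (δ₁ m : ℝ) : Prop :=
  ∀ (ω : Set ℂ) (ε : ℝ) (u : ℂ → ℂ) (t φ : ℂ → ℝ),
    IsOpen ω → Bornology.IsBounded ω → ω.Nonempty → SimplyConnectedSpace ↥ω →
    0 < ε → ContDiffOn ℝ (⊤ : ℕ∞) u ω → ContinuousOn u (closure ω) →
    (∀ x ∈ ω, lapC u x = (ε ^ 2)⁻¹ • gradW W (u x)) →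
    (∀ x ∈ closure ω, Metric.infDist (u x) Γ ≤ δ₁) →
    PhaseDecomp Γ τ (closure ω) u t φ →
    sInf ((fun x => φ x - m * t x ^ 2 / 2) '' closure ω) =
        sInf ((fun x => φ x - m * t x ^ 2 / 2) '' frontier ω) ∧
      sSup ((fun x => φ x + m * t x ^ 2 / 2) '' closure ω) =
        sSup ((fun x => φ x + m * t x ^ 2 / 2) '' frontier ω)

/-- The cross product (signed area) of two plane vectors. -/
def cross (z w : ℂ) : ℝ := z.re * w.im - z.im * w.re

lemma continuous_cross : Continuous fun p : ℂ × ℂ => cross p.1 p.2 := by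
  unfold cross
  fun_prop

lemma cross_smul_self (r : ℝ) (z : ℂ) : cross (r • z) z = 0 := by
  simp [cross]; ring

/-- A segment leaving an open set has a first exit point, which is a frontier point. -/
lemma exists_first_exit {Ω : Set ℂ} (hΩ : IsOpen Ω) {a v : ℂ} (ha : a ∈ Ω) (hb : a + v ∉ Ω) :
    ∃ t : ℝ, 0 < t ∧ t ≤ 1 ∧ a + t • v ∈ frontier Ω ∧
      ∀ r : ℝ, 0 ≤ r → r < t → a + r • v ∈ Ω := by
  have hcont : Continuous fun t : ℝ => a + t • v := by fun_prop
  have hcl : IsClosed ((fun t : ℝ => a + t • v) ⁻¹' Ωᶜ) := hΩ.isClosed_compl.preimage hcont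
  have hcpt : IsCompact (Icc (0 : ℝ) 1 ∩ (fun t : ℝ => a + t • v) ⁻¹' Ωᶜ) :=
    isCompact_Icc.inter_right hcl
  obtain ⟨t, ⟨⟨ht0, ht1⟩, htΩ⟩, hmin⟩ := hcpt.exists_isLeast ⟨1, by simp, by simpa using hb⟩
  have hin : ∀ r : ℝ, 0 ≤ r → r < t → a + r • v ∈ Ω := by
    intro r hr0 hrt
    by_contra h
    exact absurd (hmin ⟨⟨hr0, hrt.le.trans ht1⟩, h⟩) (not_le.2 hrt)
  have htpos : 0 < t := by
    rcases ht0.eq_or_lt with h | h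
    · exfalso
      apply htΩ
      simpa [← h] using ha
    · exact h
  refine ⟨t, htpos, ht1, ?_, hin⟩
  rw [hΩ.frontier_eq]
  refine ⟨?_, htΩ⟩
  have htend : Tendsto (fun r : ℝ => a + r • v) (𝓝[<] t) (𝓝 (a + t • v)) :=
    (hcont.tendsto t).mono_left nhdsWithin_le_nhds
  refine mem_closure_of_tendsto htend ?_
  filter_upwards [Ioo_mem_nhdsLT htpos] with r hr using hin r hr.1.le hr.2

section StarShaped

variable {Ω : Set ℂ} {γ γ' : ℝ → ℂ} {L : ℝ}

/-- The parameters whose boundary point is visible from the origin form a closed set. -/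
lemma isClosed_visible (hΩ : IsOpen Ω) (h0 : (0 : ℂ) ∈ Ω)
    (hγd : ∀ s, HasDerivAt γ (γ' s) s)
    (hcr : ∀ s, cross (γ s) (γ' s) ≠ 0) (hfr : range γ = frontier Ω) :
    IsClosed {s : ℝ | ∀ r : ℝ, 0 ≤ r → r < 1 → r • γ s ∈ Ω} := by
  have hγc : Continuous γ := continuous_iff_continuousAt.2 fun s => (hγd s).continuousAt
  rw [← isOpen_compl_iff, isOpen_iff_mem_nhds]
  intro s hs
  simp only [mem_compl_iff, mem_ofPred_eq, not_forall] at hs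
  obtain ⟨r, hr0, hr1, hr⟩ := hs
  obtain ⟨t', ht0, ht1, htf, -⟩ := exists_first_exit hΩ h0 (v := r • γ s) (by simpa using hr)
  rw [← hfr] at htf
  obtain ⟨σ, hσ⟩ := htf
  obtain ⟨t, htdef⟩ : ∃ t, t = t' * r := ⟨_, rfl⟩
  have hσ' : γ σ = t • γ s := by rw [hσ, htdef, zero_add, smul_smul]
  have hne : ∀ y, γ y ≠ 0 := by
    intro y hy
    have := hcr y
    simp [hy, cross] at this
  have ht1' : t < 1 := by rw [htdef]; nlinarith
  have htpos : 0 < t := by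
    rcases (show 0 ≤ t by rw [htdef]; positivity).eq_or_lt with h | h
    · exact absurd (by rw [hσ', ← h, zero_smul]) (hne σ)
    · exact h
  -- nearby pairs satisfy the two strict inequalities
  let q : ℝ × ℝ → ℝ := fun p => (γ p.1).re * (γ p.2).re + (γ p.1).im * (γ p.2).im
  let N : ℝ → ℝ := fun x => (γ x).re ^ 2 + (γ x).im ^ 2
  have hq : Continuous q := by fun_prop
  have hN : Continuous N := by fun_prop
  have hNpos : ∀ x, 0 < N x := by
    intro x
    have : 0 < Complex.normSq (γ x) := Complex.normSq_pos.2 (hne x)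
    rw [Complex.normSq_apply] at this
    simp only [N]; nlinarith
  have hqs : q (σ, s) = t * N s := by
    simp only [q, N, hσ', Complex.real_smul, Complex.re_ofReal_mul, Complex.im_ofReal_mul]; ring
  have ev : ∀ᶠ p : ℝ × ℝ in 𝓝 σ ×ˢ 𝓝 s, 0 < q p ∧ q p < N p.2 := by
    rw [← nhds_prod_eq]
    refine (hq.continuousAt.eventually (lt_mem_nhds ?_)).and
      ((hq.continuousAt.prodMk (hN.comp continuous_snd).continuousAt).eventually
        (IsOpen.mem_nhds (isOpen_lt continuous_fst continuous_snd) ?_))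
    · rw [hqs]; have := hNpos s; positivity
    · change q (σ, s) < N s
      rw [hqs]; nlinarith [hNpos s]
  obtain ⟨p1, hp1, p2, hp2, hpp⟩ := eventually_prod_iff.1 ev
  obtain ⟨η, hη, hball⟩ := Metric.eventually_nhds_iff.1 hp1
  -- sign change of `cross (γ y) (γ s)` at `y = σ`
  let f : ℝ → ℝ → ℝ := fun x y => cross (γ y) (γ x)
  have hfc : ∀ x, Continuous (f x) := fun x => by
    simp only [f]; exact continuous_cross.comp (hγc.prodMk continuous_const)
  have hfc' : ∀ y, Continuous (fun x => f x y) := fun x => by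
    simp only [f]; exact continuous_cross.comp (continuous_const.prodMk hγc)
  have hfd : HasDerivAt (f s) (cross (γ' σ) (γ s)) σ := by
    have h1 := (hγd σ)
    have hre : HasDerivAt (fun y => (γ y).re) (γ' σ).re σ :=
      (Complex.reCLM.hasFDerivAt.comp_hasDerivAt σ h1)
    have him : HasDerivAt (fun y => (γ y).im) (γ' σ).im σ :=
      (Complex.imCLM.hasFDerivAt.comp_hasDerivAt σ h1)
    exact (hre.mul_const _).sub (him.mul_const _)
  have hd0 : cross (γ' σ) (γ s) ≠ 0 := by
    intro h
    apply hcr σ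
    rw [hσ']
    simp only [cross, Complex.real_smul, Complex.re_ofReal_mul, Complex.im_ofReal_mul] at h ⊢
    linear_combination (-t) * h
  have hf0 : f s σ = 0 := by simp only [f, hσ', cross_smul_self]
  have hsign : ∃ y₁ y₂, |y₁ - σ| < η ∧ |y₂ - σ| < η ∧ f s y₁ < 0 ∧ 0 < f s y₂ := by
    by_contra! hcon
    rcases lt_or_gt_of_ne hd0 with hneg | hpos
    all_goals
      have hext : IsLocalExtr (f s) σ := by
        by_cases h : ∃ y₁, |y₁ - σ| < η ∧ f s y₁ < 0
        · obtain ⟨y₁, h1, h2⟩ := h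
          right
          filter_upwards [Metric.ball_mem_nhds σ hη] with y hy
          rw [hf0]
          exact hcon y₁ y h1 hy h2
        · push Not at h
          left
          filter_upwards [Metric.ball_mem_nhds σ hη] with y hy
          rw [hf0]
          exact h y hy
      exact hd0 (hext.hasDerivAt_eq_zero hfd)
  obtain ⟨y₁, y₂, hy₁, hy₂, hf₁, hf₂⟩ := hsign
  have e1 : ∀ᶠ x in 𝓝 s, f x y₁ < 0 := (hfc' y₁).continuousAt.eventually (gt_mem_nhds hf₁)
  have e2 : ∀ᶠ x in 𝓝 s, 0 < f x y₂ := (hfc' y₂).continuousAt.eventually (lt_mem_nhds hf₂)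
  filter_upwards [e1, e2, hp2] with x hx1 hx2 hx3
  obtain ⟨y, hy, hfy⟩ : ∃ y ∈ uIcc y₁ y₂, f x y = 0 := by
    have := intermediate_value_uIcc (a := y₁) (b := y₂) (hfc x).continuousOn
    obtain ⟨y, hy, hy'⟩ := this (show (0 : ℝ) ∈ uIcc (f x y₁) (f x y₂) from
      Icc_subset_uIcc ⟨hx1.le, hx2.le⟩)
    exact ⟨y, hy, hy'⟩
  have hyη : dist y σ < η := by
    have : uIcc y₁ y₂ ⊆ ball σ η := by
      rw [← segment_eq_uIcc]
      exact (convex_ball σ η).segment_subset hy₁ hy₂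
    exact this hy
  obtain ⟨hq0, hq1⟩ := hpp (hball hyη) hx3
  simp only at hq1
  have hNx := hNpos x
  intro hA
  have hmem := hA (q (y, x) / N x) (by positivity) ((div_lt_one hNx).2 hq1)
  have heq : (q (y, x) / N x) • γ x = γ y := by
    have hfy' : (γ y).re * (γ x).im - (γ y).im * (γ x).re = 0 := hfy
    apply Complex.ext
    · simp only [Complex.real_smul, Complex.re_ofReal_mul]
      rw [div_mul_eq_mul_div, div_eq_iff hNx.ne']
      simp only [q, N]; linear_combination (-(γ x).im) * hfy'
    · simp only [Complex.real_smul, Complex.im_ofReal_mul]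
      rw [div_mul_eq_mul_div, div_eq_iff hNx.ne']
      simp only [q, N]; linear_combination ((γ x).re) * hfy'
  rw [heq] at hmem
  have hfry : γ y ∈ frontier Ω := hfr ▸ mem_range_self y
  rw [hΩ.frontier_eq] at hfry
  exact hfry.2 hmem

/-- The parameters whose boundary point is visible from the origin form an open set. -/
lemma isOpen_visible (hΩ : IsOpen Ω) (h0 : (0 : ℂ) ∈ Ω) (hL : 0 < L)
    (hγd : ∀ s, HasDerivAt γ (γ' s) s) (hγ'c : Continuous γ')
    (hper : Function.Periodic γ L) (hinj : ∀ s t : ℝ, γ s = γ t → ∃ k : ℤ, s - t = L * k)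
    (hcr : ∀ s, cross (γ s) (γ' s) ≠ 0) (hfr : range γ = frontier Ω) :
    IsOpen {s : ℝ | ∀ r : ℝ, 0 ≤ r → r < 1 → r • γ s ∈ Ω} := by
  have hγc : Continuous γ := continuous_iff_continuousAt.2 fun s => (hγd s).continuousAt
  have hnotin : ∀ y, γ y ∉ Ω := fun y hy => by
    have hfry : γ y ∈ frontier Ω := hfr ▸ mem_range_self y
    rw [hΩ.frontier_eq] at hfry
    exact hfry.2 hy
  rw [isOpen_iff_mem_nhds]
  intro s hs
  by_contra hcon
  obtain ⟨x, hx, hxA⟩ := exists_seq_forall_of_frequently (not_eventually.1 hcon)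
  have hex : ∀ k, ∃ t σ : ℝ, t ∈ Icc (0 : ℝ) 1 ∧ t < 1 ∧ σ ∈ Icc (s - L / 2) (s + L / 2) ∧
      γ σ = t • γ (x k) := by
    intro k
    have := hxA k
    simp only [not_forall] at this
    obtain ⟨r, hr0, hr1, hr⟩ := this
    obtain ⟨t', ht0, ht1, htf, -⟩ := exists_first_exit hΩ h0 (v := r • γ (x k)) (by simpa using hr)
    rw [← hfr] at htf
    obtain ⟨σ, hσ⟩ := htf
    obtain ⟨σ', hσ', hσσ⟩ := hper.exists_mem_Ico hL σ (s - L / 2)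
    refine ⟨t' * r, σ', ⟨by positivity, by nlinarith⟩, by nlinarith,
      ⟨hσ'.1, by linarith [hσ'.2]⟩, ?_⟩
    rw [← hσσ, hσ, zero_add, smul_smul]
  choose t σ ht ht1 hσ hγσ using hex
  obtain ⟨⟨t₀, σ₀⟩, ⟨ht₀, hσ₀⟩, φ, hφ, hlim⟩ :=
    (isCompact_Icc.prod isCompact_Icc).tendsto_subseq
      (x := fun k => (t k, σ k)) (fun k => ⟨ht k, hσ k⟩)
  have hlt : Tendsto (fun k => t (φ k)) atTop (𝓝 t₀) := (continuous_fst.tendsto _).comp hlim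
  have hlσ : Tendsto (fun k => σ (φ k)) atTop (𝓝 σ₀) := (continuous_snd.tendsto _).comp hlim
  have hlx : Tendsto (fun k => x (φ k)) atTop (𝓝 s) := hx.comp hφ.tendsto_atTop
  have heq : γ σ₀ = t₀ • γ s := by
    refine tendsto_nhds_unique ((hγc.tendsto _).comp hlσ) ?_
    have := hlt.smul ((hγc.tendsto _).comp hlx)
    refine this.congr fun k => ?_
    simp [hγσ]
  have ht₀1 : t₀ = 1 := by
    by_contra hne
    exact hnotin σ₀ (heq ▸ hs t₀ ht₀.1 (lt_of_le_of_ne ht₀.2 hne))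
  rw [ht₀1, one_smul] at heq
  obtain ⟨k, hk⟩ := hinj _ _ heq
  have hσs : σ₀ = s := by
    have h1 : |L * (k : ℝ)| ≤ L / 2 := by
      rw [← hk, abs_le]; constructor <;> linarith [hσ₀.1, hσ₀.2]
    rw [abs_mul, abs_of_pos hL] at h1
    have h2 : |(k : ℝ)| < 1 := by nlinarith
    have h3 : k = 0 := by
      have : |k| < 1 := by exact_mod_cast h2
      exact Int.abs_lt_one_iff.1 this
    rw [h3] at hk; push_cast at hk; linarith
  rw [hσs] at hlσ
  -- Rolle's theorem between `x k` and `σ k`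
  have hnz : ∀ᶠ p : ℝ × ℝ in 𝓝 (s, s), cross (γ' p.1) (γ p.2) ≠ 0 := by
    have hc : Continuous fun p : ℝ × ℝ => cross (γ' p.1) (γ p.2) :=
      continuous_cross.comp ((hγ'c.comp continuous_fst).prodMk (hγc.comp continuous_snd))
    refine hc.continuousAt.eventually (isOpen_ne.mem_nhds ?_)
    intro h
    apply hcr s
    simp only [cross] at h ⊢
    linear_combination -h
  rw [nhds_prod_eq] at hnz
  obtain ⟨p1, hp1, p2, hp2, hpp⟩ := eventually_prod_iff.1 hnz
  obtain ⟨η, hη, hball⟩ := Metric.eventually_nhds_iff.1 hp1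
  obtain ⟨k, hk1, hk2, hk3⟩ := ((hlσ.eventually (ball_mem_nhds s hη)).and
    ((hlx.eventually (ball_mem_nhds s hη)).and (hlx.eventually hp2))).exists
  have hne : σ (φ k) ≠ x (φ k) := by
    intro h
    have h1 := hγσ (φ k)
    rw [h] at h1
    have h2 : (1 - t (φ k)) • γ (x (φ k)) = 0 := by
      rw [sub_smul, one_smul, ← h1, sub_self]
    rcases smul_eq_zero.1 h2 with h3 | h3
    · linarith [ht1 (φ k)]
    · exact hnotin _ (h3 ▸ h0)
  have hfd : ∀ y, HasDerivAt (fun y => cross (γ y) (γ (x (φ k)))) (cross (γ' y) (γ (x (φ k)))) y := by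
    intro y
    have hre : HasDerivAt (fun y => (γ y).re) (γ' y).re y :=
      (Complex.reCLM.hasFDerivAt.comp_hasDerivAt y (hγd y))
    have him : HasDerivAt (fun y => (γ y).im) (γ' y).im y :=
      (Complex.imCLM.hasFDerivAt.comp_hasDerivAt y (hγd y))
    exact (hre.mul_const _).sub (him.mul_const _)
  have hz1 : cross (γ (σ (φ k))) (γ (x (φ k))) = 0 := by rw [hγσ, cross_smul_self]
  have hz2 : cross (γ (x (φ k))) (γ (x (φ k))) = 0 := by simp only [cross]; ring
  obtain ⟨ξ, hξ, hξ0⟩ : ∃ ξ ∈ ball s η, cross (γ' ξ) (γ (x (φ k))) = 0 := by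
    rcases lt_or_gt_of_ne hne with h | h
    · obtain ⟨ξ, hξ, h'⟩ := exists_hasDerivAt_eq_zero h
        (fun y _ => (hfd y).continuousAt.continuousWithinAt) (hz1.trans hz2.symm) fun y _ => hfd y
      refine ⟨ξ, ?_, h'⟩
      have : Icc (σ (φ k)) (x (φ k)) ⊆ ball s η := by
        rw [← segment_eq_Icc h.le]
        exact (convex_ball s η).segment_subset hk1 hk2
      exact this (Ioo_subset_Icc_self hξ)
    · obtain ⟨ξ, hξ, h'⟩ := exists_hasDerivAt_eq_zero h
        (fun y _ => (hfd y).continuousAt.continuousWithinAt) (hz2.trans hz1.symm) fun y _ => hfd y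
      refine ⟨ξ, ?_, h'⟩
      have : Icc (x (φ k)) (σ (φ k)) ⊆ ball s η := by
        rw [← segment_eq_Icc h.le]
        exact (convex_ball s η).segment_subset hk2 hk1
      exact this (Ioo_subset_Icc_self hξ)
  exact hpp (hball hξ) hk3 hξ0

/-- A bounded open set containing `0` whose frontier is a simple closed curve transverse to the
rays from the origin is star-shaped with respect to the origin. -/
lemma smul_boundary_mem (hΩ : IsOpen Ω) (hb : IsBounded Ω) (h0 : (0 : ℂ) ∈ Ω) (hL : 0 < L)
    (hγd : ∀ s, HasDerivAt γ (γ' s) s) (hγ'c : Continuous γ')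
    (hper : Function.Periodic γ L) (hinj : ∀ s t : ℝ, γ s = γ t → ∃ k : ℤ, s - t = L * k)
    (hcr : ∀ s, cross (γ s) (γ' s) ≠ 0) (hfr : range γ = frontier Ω)
    (s r : ℝ) (hr0 : 0 ≤ r) (hr1 : r < 1) : r • γ s ∈ Ω := by
  have hclopen : IsClopen {s : ℝ | ∀ r : ℝ, 0 ≤ r → r < 1 → r • γ s ∈ Ω} :=
    ⟨isClosed_visible hΩ h0 hγd hcr hfr, isOpen_visible hΩ h0 hL hγd hγ'c hper hinj hcr hfr⟩
  obtain ⟨R, hR⟩ := hb.subset_ball 0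
  have hout : (0 : ℂ) + ((|R| : ℝ) : ℂ) ∉ Ω := fun h => by
    have := hR h
    simp at this
    linarith [le_abs_self R]
  obtain ⟨t, ht0, ht1, htf, hin⟩ := exists_first_exit hΩ h0 hout
  rw [← hfr] at htf
  obtain ⟨σ, hσ⟩ := htf
  have hne : {s : ℝ | ∀ r : ℝ, 0 ≤ r → r < 1 → r • γ s ∈ Ω}.Nonempty := by
    refine ⟨σ, fun r hr0 hr1 => ?_⟩
    have := hin (r * t) (by positivity) (by nlinarith)
    rwa [zero_add, mul_smul, ← zero_add (t • _), ← hσ] at this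
  have := hclopen.eq_univ hne
  exact (this ▸ mem_univ s : s ∈ {s : ℝ | ∀ r : ℝ, 0 ≤ r → r < 1 → r • γ s ∈ Ω}) r hr0 hr1

end StarShaped

/-- `f₁`, `f₂` are the partial derivatives of the differentiable function `f` on the plane. -/
def HasPartials (f f₁ f₂ : ℂ → ℝ) : Prop :=
  ∀ z, HasFDerivAt f (f₁ z • reCLM + f₂ z • imCLM) z

namespace HasPartials

variable {f f₁ f₂ g g₁ g₂ : ℂ → ℝ}

lemma differentiable (hf : HasPartials f f₁ f₂) : Differentiable ℝ f :=
  fun z => (hf z).differentiableAt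

lemma continuous (hf : HasPartials f f₁ f₂) : Continuous f := hf.differentiable.continuous

lemma add (hf : HasPartials f f₁ f₂) (hg : HasPartials g g₁ g₂) :
    HasPartials (fun z => f z + g z) (fun z => f₁ z + g₁ z) (fun z => f₂ z + g₂ z) := by
  intro z
  refine ((hf z).add (hg z)).congr_fderiv ?_
  ext v; simp; ring

lemma sub (hf : HasPartials f f₁ f₂) (hg : HasPartials g g₁ g₂) :
    HasPartials (fun z => f z - g z) (fun z => f₁ z - g₁ z) (fun z => f₂ z - g₂ z) := by
  intro z
  refine ((hf z).sub (hg z)).congr_fderiv ?_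
  ext v; simp; ring

lemma mul (hf : HasPartials f f₁ f₂) (hg : HasPartials g g₁ g₂) :
    HasPartials (fun z => f z * g z) (fun z => f₁ z * g z + f z * g₁ z)
      (fun z => f₂ z * g z + f z * g₂ z) := by
  intro z
  refine ((hf z).mul (hg z)).congr_fderiv ?_
  ext v; simp; ring

lemma const_mul (k : ℝ) (hf : HasPartials f f₁ f₂) :
    HasPartials (fun z => k * f z) (fun z => k * f₁ z) (fun z => k * f₂ z) := by
  intro z
  refine ((hf z).const_mul k).congr_fderiv ?_
  ext v; simp; ring

lemma re : HasPartials (fun z => z.re) (fun _ => 1) (fun _ => 0) := by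
  intro z
  refine (reCLM.hasFDerivAt (x := z)).congr_fderiv ?_
  ext v; simp

lemma im : HasPartials (fun z => z.im) (fun _ => 0) (fun _ => 1) := by
  intro z
  refine (imCLM.hasFDerivAt (x := z)).congr_fderiv ?_
  ext v; simp

/-- Chain rule along a curve. -/
lemma comp_curve (hf : HasPartials f f₁ f₂) {γ : ℝ → ℂ} {v : ℂ} {s : ℝ}
    (hγ : HasDerivAt γ v s) :
    HasDerivAt (fun t => f (γ t)) (f₁ (γ s) * v.re + f₂ (γ s) * v.im) s := by
  refine ((hf (γ s)).comp_hasDerivAt s hγ).congr_deriv ?_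
  simp

/-- Chain rule for a composition with a map given by its two components. -/
lemma comp_map (hf : HasPartials f f₁ f₂) {u : ℂ → ℂ} {a₁ a₂ b₁ b₂ : ℂ → ℝ}
    (ha : HasPartials (fun z => (u z).re) a₁ a₂) (hb : HasPartials (fun z => (u z).im) b₁ b₂) :
    HasPartials (fun z => f (u z)) (fun z => f₁ (u z) * a₁ z + f₂ (u z) * b₁ z)
      (fun z => f₁ (u z) * a₂ z + f₂ (u z) * b₂ z) := by
  intro z
  have hu : HasFDerivAt u ((equivRealProdCLM.symm : ℝ × ℝ →L[ℝ] ℂ).comp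
      ((a₁ z • reCLM + a₂ z • imCLM).prod (b₁ z • reCLM + b₂ z • imCLM))) z := by
    have h1 := (ha z).prodMk (hb z)
    have h2 := (equivRealProdCLM.symm : ℝ × ℝ →L[ℝ] ℂ).hasFDerivAt.comp z h1
    refine h2.congr_of_eventuallyEq (Eventually.of_forall fun y => ?_)
    apply Complex.ext <;> simp
  refine ((hf (u z)).comp z hu).congr_fderiv ?_
  ext v
  simp
  ring

end HasPartials

/-- The divergence theorem on the plane domain `Ω`, as a one-sided estimate: if the flux density
along the boundary is at least `-C`, the integral of the divergence is at least `-(C * K)`. -/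
def FluxBound (Ω : Set ℂ) (γ nv : ℝ → ℂ) (K : ℝ) : Prop :=
  ∀ (P P₁ P₂ Q Q₁ Q₂ : ℂ → ℝ), HasPartials P P₁ P₂ → HasPartials Q Q₁ Q₂ →
    Continuous P₁ → Continuous Q₂ → ∀ C : ℝ,
    (∀ s, -C ≤ P (γ s) * (nv s).re + Q (γ s) * (nv s).im) →
    -(C * K) ≤ ∫ z in Ω, (P₁ z + Q₂ z)

section Divergence

variable {Ω : Set ℂ} {γ γ' γ'' : ℝ → ℂ} {L : ℝ}

/-- Polar-type coordinates `(r, s) ↦ r • γ s`, with `(r, s)` encoded as `r + s * I`. -/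
def coneMap (γ : ℝ → ℂ) (z : ℂ) : ℂ := z.re • γ z.im

lemma hasFDerivAt_coneMap (hγd : ∀ s, HasDerivAt γ (γ' s) s) (z : ℂ) :
    HasFDerivAt (coneMap γ)
      (z.re • (imCLM.smulRight (γ' z.im)) + reCLM.smulRight (γ z.im)) z := by
  have h1 : HasFDerivAt (fun z : ℂ => γ z.im) (imCLM.smulRight (γ' z.im)) z := by
    refine ((hγd z.im).hasFDerivAt.comp z imCLM.hasFDerivAt).congr_fderiv ?_
    ext v
    simp
  exact (reCLM.hasFDerivAt (x := z)).smul h1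

lemma det_coneMap (a b : ℂ) (r : ℝ) :
    (r • (imCLM.smulRight b) + reCLM.smulRight a : ℂ →L[ℝ] ℂ).det = r * cross a b := by
  rw [ContinuousLinearMap.det, ← LinearMap.det_toMatrix Complex.basisOneI, Matrix.det_fin_two]
  simp [LinearMap.toMatrix_apply, cross]
  ring

lemma image_coneMap (hΩ : IsOpen Ω) (hb : IsBounded Ω) (h0 : (0 : ℂ) ∈ Ω) (hL : 0 < L)
    (hγd : ∀ s, HasDerivAt γ (γ' s) s) (hγ'c : Continuous γ')
    (hper : Function.Periodic γ L) (hinj : ∀ s t : ℝ, γ s = γ t → ∃ k : ℤ, s - t = L * k)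
    (hcr : ∀ s, cross (γ s) (γ' s) ≠ 0) (hfr : range γ = frontier Ω) :
    coneMap γ '' (Ioo 0 1 ×ℂ Ioc 0 L) = Ω \ {0} ∧ InjOn (coneMap γ) (Ioo 0 1 ×ℂ Ioc 0 L) := by
  have hstar := smul_boundary_mem hΩ hb h0 hL hγd hγ'c hper hinj hcr hfr
  have hnotin : ∀ y, γ y ∉ Ω := fun y hy => by
    have hfry : γ y ∈ frontier Ω := hfr ▸ mem_range_self y
    rw [hΩ.frontier_eq] at hfry
    exact hfry.2 hy
  have hne : ∀ y, γ y ≠ 0 := fun y hy => hnotin y (hy ▸ h0)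
  constructor
  · ext z
    constructor
    · rintro ⟨w, ⟨hw1, hw2⟩, rfl⟩
      exact ⟨hstar w.im w.re hw1.1.le hw1.2, by simp [coneMap, hne, hw1.1.ne']⟩
    · rintro ⟨hz, hz0⟩
      obtain ⟨R, hR⟩ := hb.subset_ball 0
      have hzpos : 0 < ‖z‖ := norm_pos_iff.2 hz0
      have hout : z + (|R| / ‖z‖) • z ∉ Ω := fun h => by
        have := hR h
        rw [show z + (|R| / ‖z‖) • z = (1 + |R| / ‖z‖) • z by rw [add_smul, one_smul],
          mem_ball_zero_iff, norm_smul, Real.norm_of_nonneg (by positivity), add_mul,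
          div_mul_cancel₀ _ hzpos.ne'] at this
        linarith [le_abs_self R]
      obtain ⟨t, ht0, ht1, htf, -⟩ := exists_first_exit hΩ hz hout
      rw [← hfr] at htf
      obtain ⟨σ, hσ⟩ := htf
      obtain ⟨κ, hκ⟩ : ∃ κ, κ = 1 + t * (|R| / ‖z‖) := ⟨_, rfl⟩
      have hσ' : γ σ = κ • z := by rw [hσ, hκ, add_smul, one_smul, smul_smul]
      have hκ1 : 1 ≤ κ := by rw [hκ]; have : 0 ≤ t * (|R| / ‖z‖) := by positivity
                             linarith
      have hκ1' : 1 < κ := by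
        rcases hκ1.eq_or_lt with h | h
        · rw [← h, one_smul] at hσ'
          exact absurd (hσ' ▸ hz) (hnotin σ)
        · exact h
      obtain ⟨s, hs, hss⟩ := hper.exists_mem_Ioc hL σ 0
      rw [zero_add] at hs
      refine ⟨⟨κ⁻¹, s⟩, ⟨⟨by simp only; positivity, by simp only; exact inv_lt_one_of_one_lt₀ hκ1'⟩, hs⟩, ?_⟩
      simp only [coneMap]
      rw [← hss, hσ', smul_smul, inv_mul_cancel₀ (by positivity), one_smul]
  · have key : ∀ r r' s s' : ℝ, 0 < r → r < r' → r • γ s ≠ r' • γ s' := by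
      intro r r' s s' hr hrr h
      have hr' : 0 < r' := hr.trans hrr
      apply hnotin s'
      have : γ s' = (r / r') • γ s := by
        rw [div_eq_inv_mul, mul_smul, h, smul_smul, inv_mul_cancel₀ hr'.ne', one_smul]
      rw [this]
      exact hstar _ _ (by positivity) ((div_lt_one hr').2 hrr)
    rintro z ⟨hz1, hz2⟩ w ⟨hw1, hw2⟩ h
    simp only [coneMap] at h
    have hre : z.re = w.re := by
      rcases lt_trichotomy z.re w.re with hlt | heq | hlt
      · exact absurd h (key _ _ _ _ hz1.1 hlt)
      · exact heq
      · exact absurd h.symm (key _ _ _ _ hw1.1 hlt)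
    rw [hre] at h
    have hγeq : γ z.im = γ w.im := smul_right_injective ℂ hw1.1.ne' h
    obtain ⟨k, hk⟩ := hinj _ _ hγeq
    have hk1 : |L * (k : ℝ)| < L := by
      rw [← hk, abs_lt]; constructor <;> linarith [hz2.1, hz2.2, hw2.1, hw2.2]
    rw [abs_mul, abs_of_pos hL] at hk1
    have h2 : |(k : ℝ)| < 1 := by nlinarith
    have h3 : k = 0 := by
      have : |k| < 1 := by exact_mod_cast h2
      exact Int.abs_lt_one_iff.1 this
    apply Complex.ext hre
    rw [h3] at hk; push_cast at hk; linarith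

/-- A continuous function without zeros on the line has a constant sign. -/
lemma exists_sign {f : ℝ → ℝ} (hf : Continuous f) (h : ∀ s, f s ≠ 0) :
    ∃ σ : ℝ, (σ = 1 ∨ σ = -1) ∧ ∀ s, |f s| = σ * f s ∧ 0 < σ * f s := by
  have hpos : (∀ s, 0 < f s) ∨ ∀ s, f s < 0 := by
    by_contra! hcon
    obtain ⟨⟨s, hs⟩, t, ht⟩ := hcon
    obtain ⟨y, hy⟩ := mem_range_of_exists_le_of_exists_ge hf ⟨s, hs⟩ ⟨t, ht⟩
    exact h y hy
  rcases hpos with hp | hp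
  · exact ⟨1, Or.inl rfl, fun s => by rw [abs_of_pos (hp s)]; simp [hp s]⟩
  · exact ⟨-1, Or.inr rfl, fun s => by rw [abs_of_neg (hp s)]; simp [hp s]⟩

/-- Integration over `Ω` in the coordinates `(r, s) ↦ r • γ s`. -/
lemma setIntegral_eq_cone (hΩ : IsOpen Ω) (hb : IsBounded Ω) (h0 : (0 : ℂ) ∈ Ω) (hL : 0 < L)
    (hγd : ∀ s, HasDerivAt γ (γ' s) s) (hγ'c : Continuous γ')
    (hper : Function.Periodic γ L) (hinj : ∀ s t : ℝ, γ s = γ t → ∃ k : ℤ, s - t = L * k)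
    (hcr : ∀ s, cross (γ s) (γ' s) ≠ 0) (hfr : range γ = frontier Ω)
    {F : ℂ → ℝ} (hF : Continuous F) :
    ∫ z in Ω, F z = ∫ r in (0 : ℝ)..1, ∫ s in (0 : ℝ)..L,
      r * |cross (γ s) (γ' s)| * F (r • γ s) := by
  have hγc : Continuous γ := continuous_iff_continuousAt.2 fun s => (hγd s).continuousAt
  obtain ⟨himg, hinjOn⟩ := image_coneMap hΩ hb h0 hL hγd hγ'c hper hinj hcr hfr
  have hS : MeasurableSet (Ioo 0 1 ×ℂ Ioc 0 L) :=
    (measurable_re measurableSet_Ioo).inter (measurable_im measurableSet_Ioc)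
  have h1 : ∫ z in Ω, F z = ∫ z in Ω \ {0}, F z :=
    setIntegral_congr_set (sdiff_null_ae_eq_self (measure_singleton _)).symm
  rw [h1, ← himg, integral_image_eq_integral_abs_det_fderiv_smul volume hS
    (fun z _ => (hasFDerivAt_coneMap hγd z).hasFDerivWithinAt) hinjOn]
  simp only [det_coneMap, coneMap, smul_eq_mul]
  have h2 : ∫ z in Ioo 0 1 ×ℂ Ioc 0 L, |z.re * cross (γ z.im) (γ' z.im)| * F (z.re • γ z.im) =
      ∫ p in Ioo (0 : ℝ) 1 ×ˢ Ioc 0 L,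
        |p.1 * cross (γ p.2) (γ' p.2)| * F (p.1 • γ p.2) := by
    rw [← Complex.volume_preserving_equiv_real_prod.setIntegral_preimage_emb
      Complex.measurableEquivRealProd.measurableEmbedding]
    rfl
  have hcc : Continuous fun p : ℝ × ℝ => |p.1 * cross (γ p.2) (γ' p.2)| * F (p.1 • γ p.2) := by
    have : Continuous fun p : ℝ × ℝ => cross (γ p.2) (γ' p.2) :=
      continuous_cross.comp ((hγc.comp continuous_snd).prodMk (hγ'c.comp continuous_snd))
    fun_prop
  rw [h2, Measure.volume_eq_prod, setIntegral_prod, intervalIntegral.integral_of_le zero_le_one,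
    integral_Ioc_eq_integral_Ioo]
  · refine setIntegral_congr_fun measurableSet_Ioo fun r hr => ?_
    simp only
    rw [intervalIntegral.integral_of_le hL.le]
    simp only [abs_mul, abs_of_pos hr.1]
  · rw [← Measure.volume_eq_prod]
    exact (hcc.continuousOn.integrableOn_compact (isCompact_Icc.prod isCompact_Icc)).mono_set
      (prod_mono Ioo_subset_Icc_self Ioc_subset_Icc_self)

/-- Green's formula in the coordinates `(r, s) ↦ r • γ s`. -/
lemma integral_cone_divergence
    (hγd : ∀ s, HasDerivAt γ (γ' s) s) (hγd' : ∀ s, HasDerivAt γ' (γ'' s) s)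
    (hper : Function.Periodic γ L)
    {P P₁ P₂ Q Q₁ Q₂ : ℂ → ℝ} (hP : HasPartials P P₁ P₂) (hQ : HasPartials Q Q₁ Q₂)
    (hP₁ : Continuous P₁) (hQ₂ : Continuous Q₂) :
    ∫ r in (0 : ℝ)..1, ∫ s in (0 : ℝ)..L,
        r * cross (γ s) (γ' s) * (P₁ (r • γ s) + Q₂ (r • γ s)) =
      ∫ s in (0 : ℝ)..L, (P (γ s) * (γ' s).im - Q (γ s) * (γ' s).re) := by
  have hγD : Differentiable ℝ γ := fun s => (hγd s).differentiableAt
  have hγD' : Differentiable ℝ γ' := fun s => (hγd' s).differentiableAt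
  have hγc := hγD.continuous
  have hγ'c := hγD'.continuous
  let f : ℝ × ℝ → ℝ := fun p =>
    p.1 * (P (p.1 • γ p.2) * imCLM (γ' p.2) - Q (p.1 • γ p.2) * reCLM (γ' p.2))
  let g : ℝ × ℝ → ℝ := fun p =>
    -(P (p.1 • γ p.2) * imCLM (γ p.2) - Q (p.1 • γ p.2) * reCLM (γ p.2))
  have hPD := hP.differentiable
  have hQD := hQ.differentiable
  have hf : Differentiable ℝ f := by simp only [f]; fun_prop
  have hg : Differentiable ℝ g := by simp only [g]; fun_prop
  have hre : ∀ s, HasDerivAt (fun y => (γ y).re) (γ' s).re s := fun s =>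
    (Complex.reCLM.hasFDerivAt.comp_hasDerivAt s (hγd s))
  have him : ∀ s, HasDerivAt (fun y => (γ y).im) (γ' s).im s := fun s =>
    (Complex.imCLM.hasFDerivAt.comp_hasDerivAt s (hγd s))
  have hdiv : ∀ p : ℝ × ℝ, fderiv ℝ f p (1, 0) + fderiv ℝ g p (0, 1) =
      p.1 * cross (γ p.2) (γ' p.2) * (P₁ (p.1 • γ p.2) + Q₂ (p.1 • γ p.2)) := by
    rintro ⟨r, s⟩
    have hr : HasDerivAt (fun r : ℝ => r • γ s) (γ s) r := by
      simpa using (hasDerivAt_id r).smul_const (γ s)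
    have hs : HasDerivAt (fun s : ℝ => r • γ s) (r • γ' s) s := (hγd s).const_smul r
    have hline : HasDerivAt (fun r : ℝ => (r, s)) ((1 : ℝ), (0 : ℝ)) r :=
      (hasDerivAt_id r).prodMk (hasDerivAt_const r s)
    have hline' : HasDerivAt (fun s : ℝ => (r, s)) ((0 : ℝ), (1 : ℝ)) s :=
      (hasDerivAt_const s r).prodMk (hasDerivAt_id s)
    have d1 : HasDerivAt (f ∘ fun r : ℝ => (r, s)) _ r :=
      (hasDerivAt_id r).fun_mul (((hP.comp_curve hr).mul_const (γ' s).im).fun_sub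
        ((hQ.comp_curve hr).mul_const (γ' s).re))
    have d2 : HasDerivAt (g ∘ fun s : ℝ => (r, s)) _ s :=
      (((hP.comp_curve hs).fun_mul (him s)).fun_sub ((hQ.comp_curve hs).fun_mul (hre s))).fun_neg
    have e1 := ((hf (r, s)).hasFDerivAt.comp_hasDerivAt r hline).unique d1
    have e2 := ((hg (r, s)).hasFDerivAt.comp_hasDerivAt s hline').unique d2
    rw [e1, e2]
    simp only [cross, Complex.real_smul, Complex.re_ofReal_mul, Complex.im_ofReal_mul, id,
      Complex.reCLM_apply, Complex.imCLM_apply]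
    ring
  have hcont : Continuous fun p : ℝ × ℝ =>
      p.1 * cross (γ p.2) (γ' p.2) * (P₁ (p.1 • γ p.2) + Q₂ (p.1 • γ p.2)) := by
    have : Continuous fun p : ℝ × ℝ => cross (γ p.2) (γ' p.2) :=
      continuous_cross.comp ((hγc.comp continuous_snd).prodMk (hγ'c.comp continuous_snd))
    fun_prop
  have key := integral2_divergence_prod_of_hasFDerivAt_off_countable f g (fderiv ℝ f) (fderiv ℝ g)
    0 0 1 L ∅ countable_empty hf.continuous.continuousOn hg.continuous.continuousOn
    (fun p _ => (hf p).hasFDerivAt) (fun p _ => (hg p).hasFDerivAt) (by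
      simp only [hdiv]
      exact hcont.continuousOn.integrableOn_compact (isCompact_uIcc.prod isCompact_uIcc))
  simp only [hdiv] at key
  rw [key]
  have hγL : γ L = γ 0 := by simpa using hper 0
  simp [f, g, hγL]

/-- The divergence estimate holds on strictly star-shaped domains. -/
theorem fluxBound_of_starShaped (hΩ : IsOpen Ω) (hb : IsBounded Ω) (h0 : (0 : ℂ) ∈ Ω)
    (hγ : BoundaryParam Ω γ L) {nv : ℝ → ℂ} (hunit : ∀ s, ‖nv s‖ = 1)
    (horth : ∀ s, (nv s).re * (deriv γ s).re + (nv s).im * (deriv γ s).im = 0)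
    {c : ℝ} (hc : 0 < c) (hstar : ∀ s, c ≤ (γ s).re * (nv s).re + (γ s).im * (nv s).im) :
    FluxBound Ω γ nv L := by
  have hγ2 : ContDiff ℝ 2 γ := by exact_mod_cast contDiff_infty.1 hγ.smooth 2
  have hγ1 : ContDiff ℝ 1 (deriv γ) := by
    have : ContDiff ℝ (1 + 1) γ := hγ2
    exact (contDiff_succ_iff_deriv.1 this).2.2
  have hγd : ∀ s, HasDerivAt γ (deriv γ s) s := fun s =>
    (hγ2.differentiable (by norm_num) s).hasDerivAt
  have hγd' : ∀ s, HasDerivAt (deriv γ) (deriv (deriv γ) s) s := fun s =>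
    (hγ1.differentiable (by norm_num) s).hasDerivAt
  have hnorm : ∀ z : ℂ, ‖z‖ = 1 → z.re ^ 2 + z.im ^ 2 = 1 := by
    intro z hz
    have := Complex.sq_norm z
    rw [hz, Complex.normSq_apply] at this
    nlinarith
  obtain ⟨ν, hν⟩ : ∃ ν : ℝ → ℝ, ν = fun s => (nv s).re * (deriv γ s).im - (nv s).im * (deriv γ s).re :=
    ⟨_, rfl⟩
  have hnu : ∀ s, (nv s).re = ν s * (deriv γ s).im ∧ (nv s).im = -(ν s * (deriv γ s).re) := by
    intro s
    have h1 := hnorm _ (hγ.arclength s)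
    have h2 := horth s
    rw [hν]
    constructor
    · linear_combination (-(nv s).re) * h1 + (deriv γ s).re * h2
    · linear_combination (-(nv s).im) * h1 + (deriv γ s).im * h2
  have hνsq : ∀ s, ν s ^ 2 = 1 := by
    intro s
    have h1 := hnorm _ (hγ.arclength s)
    have h2 := hnorm _ (hunit s)
    rw [(hnu s).1, (hnu s).2] at h2
    linear_combination h2 - (ν s) ^ 2 * h1
  have hcrν : ∀ s, c ≤ ν s * cross (γ s) (deriv γ s) := by
    intro s
    have h := hstar s
    rw [(hnu s).1, (hnu s).2] at h
    simp only [cross]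
    linarith
  have hcr : ∀ s, cross (γ s) (deriv γ s) ≠ 0 := by
    intro s h
    have := hcrν s
    rw [h] at this
    linarith
  have hfr := hγ.srange
  have hcrc : Continuous fun s => cross (γ s) (deriv γ s) :=
    continuous_cross.comp (hγ2.continuous.prodMk hγ1.continuous)
  obtain ⟨σ, hσ, hsgn⟩ := exists_sign hcrc hcr
  have hσν : ∀ s, σ = ν s := by
    intro s
    have h1 := (hsgn s).2
    have h2 := hcrν s
    have h3 : ν s = 1 ∨ ν s = -1 := by
      simpa using hνsq s
    rcases hσ with h | h <;> rcases h3 with h' | h' <;> rw [h, h'] <;> rw [h] at h1 <;>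
      rw [h'] at h2 <;> linarith
  intro P P₁ P₂ Q Q₁ Q₂ hP hQ hP₁ hQ₂ C hflux
  have hcone := setIntegral_eq_cone hΩ hb h0 hγ.Lpos hγd hγ1.continuous hγ.periodic hγ.inj hcr hfr
    (F := fun z => P₁ z + Q₂ z) (hP₁.add hQ₂)
  rw [hcone]
  have hmul : ∀ r s : ℝ, r * |cross (γ s) (deriv γ s)| * (P₁ (r • γ s) + Q₂ (r • γ s)) =
      σ * (r * cross (γ s) (deriv γ s) * (P₁ (r • γ s) + Q₂ (r • γ s))) := by
    intro r s
    rw [(hsgn s).1]; ring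
  simp only [hmul, intervalIntegral.integral_const_mul]
  rw [integral_cone_divergence hγd hγd' hγ.periodic hP hQ hP₁ hQ₂,
    ← intervalIntegral.integral_const_mul]
  have hPc := hP.continuous
  have hQc := hQ.continuous
  have hγc := hγ2.continuous
  have hγ'c := hγ1.continuous
  have hmono : ∫ _ in (0 : ℝ)..L, -C ≤
      ∫ s in (0 : ℝ)..L, σ * (P (γ s) * (deriv γ s).im - Q (γ s) * (deriv γ s).re) := by
    refine intervalIntegral.integral_mono_on hγ.Lpos.le (by simp)
      (Continuous.intervalIntegrable (by fun_prop) _ _) fun s _ => ?_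
    have := hflux s
    rw [(hnu s).1, (hnu s).2, ← hσν s] at this
    linarith
  simp only [intervalIntegral.integral_const, smul_eq_mul] at hmono
  linarith

end Divergence

/-- The partial derivative in the real direction. -/
def px (f : ℂ → ℝ) (z : ℂ) : ℝ := fderiv ℝ f z 1

/-- The partial derivative in the imaginary direction. -/
def py (f : ℂ → ℝ) (z : ℂ) : ℝ := fderiv ℝ f z I

section Partials

variable {f : ℂ → ℝ}

lemma contDiff_px (hf : ContDiff ℝ (⊤ : ℕ∞) f) : ContDiff ℝ (⊤ : ℕ∞) (px f) :=
  (hf.fderiv_right (m := (⊤ : ℕ∞)) (by simp)).clm_apply contDiff_const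

lemma contDiff_py (hf : ContDiff ℝ (⊤ : ℕ∞) f) : ContDiff ℝ (⊤ : ℕ∞) (py f) :=
  (hf.fderiv_right (m := (⊤ : ℕ∞)) (by simp)).clm_apply contDiff_const

lemma differentiable_of_smooth {E : Type*} [NormedAddCommGroup E] [NormedSpace ℝ E] {u : ℂ → E}
    (hu : ContDiff ℝ (⊤ : ℕ∞) u) : Differentiable ℝ u :=
  hu.differentiable (by simp)

lemma clm_complex_eq (φ : ℂ →L[ℝ] ℝ) : φ = φ 1 • reCLM + φ I • imCLM := by
  ext v
  have h : v = v.re • (1 : ℂ) + v.im • I := by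
    apply Complex.ext <;> simp
  conv_lhs => rw [h, map_add, map_smul, map_smul]
  simp [mul_comm]

lemma hasPartials (hf : ContDiff ℝ (⊤ : ℕ∞) f) : HasPartials f (px f) (py f) := fun z =>
  (differentiable_of_smooth hf z).hasFDerivAt.congr_fderiv (clm_complex_eq _)

lemma py_px_eq (hf : ContDiff ℝ (⊤ : ℕ∞) f) : py (px f) = px (py f) := by
  ext z
  have hd : DifferentiableAt ℝ (fderiv ℝ f) z :=
    differentiable_of_smooth (hf.fderiv_right (m := (⊤ : ℕ∞)) (by simp)) z
  have hs : IsSymmSndFDerivAt ℝ f z := by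
    have h2 : ContDiff ℝ 2 f := by exact_mod_cast contDiff_infty.1 hf 2
    exact (h2.contDiffAt (x := z)).isSymmSndFDerivAt (by simp)
  have h1 : py (px f) z = fderiv ℝ (fderiv ℝ f) z I 1 := by
    change fderiv ℝ (fun y => fderiv ℝ f y 1) z I = _
    rw [fderiv_clm_apply hd (differentiableAt_const _)]
    simp
  have h2 : px (py f) z = fderiv ℝ (fderiv ℝ f) z 1 I := by
    change fderiv ℝ (fun y => fderiv ℝ f y I) z 1 = _
    rw [fderiv_clm_apply hd (differentiableAt_const _)]
    simp
  rw [h1, h2, hs.eq]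

lemma hasPartials_px (hf : ContDiff ℝ (⊤ : ℕ∞) f) :
    HasPartials (px f) (px (px f)) (px (py f)) := by
  have := hasPartials (contDiff_px hf)
  rwa [py_px_eq hf] at this

lemma hasPartials_py (hf : ContDiff ℝ (⊤ : ℕ∞) f) :
    HasPartials (py f) (px (py f)) (py (py f)) := hasPartials (contDiff_py hf)

variable {u : ℂ → ℂ}

lemma contDiff_re (hu : ContDiff ℝ (⊤ : ℕ∞) u) : ContDiff ℝ (⊤ : ℕ∞) fun z => (u z).re :=
  reCLM.contDiff.comp hu

lemma contDiff_im (hu : ContDiff ℝ (⊤ : ℕ∞) u) : ContDiff ℝ (⊤ : ℕ∞) fun z => (u z).im :=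
  imCLM.contDiff.comp hu

lemma fderiv_re (hu : Differentiable ℝ u) (z v : ℂ) :
    fderiv ℝ (fun y => (u y).re) z v = (fderiv ℝ u z v).re := by
  have := (reCLM.hasFDerivAt (x := u z)).comp z (hu z).hasFDerivAt
  rw [show (fun y => (u y).re) = reCLM ∘ u from rfl, this.fderiv]
  simp

lemma fderiv_im (hu : Differentiable ℝ u) (z v : ℂ) :
    fderiv ℝ (fun y => (u y).im) z v = (fderiv ℝ u z v).im := by
  have := (imCLM.hasFDerivAt (x := u z)).comp z (hu z).hasFDerivAt
  rw [show (fun y => (u y).im) = imCLM ∘ u from rfl, this.fderiv]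
  simp

lemma differentiable_fderiv_apply (hu : ContDiff ℝ (⊤ : ℕ∞) u) (v : ℂ) :
    Differentiable ℝ fun z => fderiv ℝ u z v :=
  differentiable_of_smooth
    ((hu.fderiv_right (m := (⊤ : ℕ∞)) (by simp)).clm_apply contDiff_const)

lemma lapC_re (hu : ContDiff ℝ (⊤ : ℕ∞) u) (z : ℂ) :
    (lapC u z).re = px (px fun y => (u y).re) z + py (py fun y => (u y).re) z := by
  have hd := differentiable_of_smooth hu
  have h1 : px (fun y => (u y).re) = fun y => (fderiv ℝ u y 1).re :=
    funext fun y => fderiv_re hd y 1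
  have h2 : py (fun y => (u y).re) = fun y => (fderiv ℝ u y I).re :=
    funext fun y => fderiv_re hd y I
  rw [h1, h2]
  simp only [px, py, lapC, Complex.add_re]
  rw [fderiv_re (differentiable_fderiv_apply hu 1), fderiv_re (differentiable_fderiv_apply hu I)]

lemma lapC_im (hu : ContDiff ℝ (⊤ : ℕ∞) u) (z : ℂ) :
    (lapC u z).im = px (px fun y => (u y).im) z + py (py fun y => (u y).im) z := by
  have hd := differentiable_of_smooth hu
  have h1 : px (fun y => (u y).im) = fun y => (fderiv ℝ u y 1).im :=
    funext fun y => fderiv_im hd y 1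
  have h2 : py (fun y => (u y).im) = fun y => (fderiv ℝ u y I).im :=
    funext fun y => fderiv_im hd y I
  rw [h1, h2]
  simp only [px, py, lapC, Complex.add_im]
  rw [fderiv_im (differentiable_fderiv_apply hu 1), fderiv_im (differentiable_fderiv_apply hu I)]

lemma gradW_re (W : ℂ → ℝ) (z : ℂ) : (gradW W z).re = px W z := by
  simp [gradW, px]

lemma gradW_im (W : ℂ → ℝ) (z : ℂ) : (gradW W z).im = py W z := by
  simp [gradW, py]

/-- The equation `Δu = ε⁻² ∇W(u)` in components. -/
lemma SolvesGL.components {W : ℂ → ℝ} {Ω : Set ℂ} {ε : ℝ} (hu : SolvesGL W Ω ε u) {x : ℂ}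
    (hx : x ∈ Ω) :
    px (px fun y => (u y).re) x + py (py fun y => (u y).re) x = (ε ^ 2)⁻¹ * px W (u x) ∧
    px (px fun y => (u y).im) x + py (py fun y => (u y).im) x = (ε ^ 2)⁻¹ * py W (u x) := by
  rw [← lapC_re hu.1, ← lapC_im hu.1, hu.2 x hx, Complex.smul_re, Complex.smul_im, gradW_re,
    gradW_im]
  simp

end Partials

/-- One-sided second derivative test. -/
lemma second_deriv_nonneg {k k' : ℝ → ℝ} {d : ℝ} (hk : ∀ t, HasDerivAt k (k' t) t)
    (hk' : HasDerivAt k' d 0) (h0 : k 0 = 0) (h0' : k' 0 = 0)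
    (hpos : ∀ᶠ s in 𝓝[>] (0 : ℝ), 0 ≤ k s) : 0 ≤ d := by
  by_contra! hd
  have hslope : ∀ᶠ t in 𝓝[>] (0 : ℝ), k' t < 0 := by
    have h1 := (hasDerivAt_iff_tendsto_slope.1 hk').mono_left
      (nhdsWithin_mono (0 : ℝ) (fun t (ht : 0 < t) => ht.ne'))
    filter_upwards [h1.eventually (gt_mem_nhds hd), self_mem_nhdsWithin] with t ht ht0
    rw [slope_def_field, h0', sub_zero, sub_zero] at ht
    have ht0' : (0 : ℝ) < t := ht0
    by_contra! hcon
    exact absurd ht (not_lt.2 (by positivity))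
  obtain ⟨c, hc, hsub⟩ := mem_nhdsGT_iff_exists_Ioo_subset.1 (hslope.and hpos)
  have hc0 : (0 : ℝ) < c := hc
  obtain ⟨ξ, hξ, hξ'⟩ := exists_hasDerivAt_eq_slope k k' (half_pos hc0)
    (fun y _ => (hk y).continuousAt.continuousWithinAt) fun y _ => hk y
  have h1 : k' ξ < 0 := (hsub ⟨hξ.1, by linarith [hξ.2]⟩).1
  have h2 : 0 ≤ k (c / 2) := (hsub ⟨half_pos hc0, by linarith⟩).2
  rw [hξ', h0] at h1
  have : 0 ≤ (k (c / 2) - 0) / (c / 2 - 0) := by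
    rw [sub_zero, sub_zero]; positivity
  linarith

/-- Second directional derivative along a line. -/
lemma hasDerivAt_line (z v : ℂ) (t : ℝ) : HasDerivAt (fun t : ℝ => z + t • v) v t := by
  simpa using ((hasDerivAt_id t).smul_const v).const_add z

lemma hessian_nonneg_of_isLocalMin {h h₁ h₂ h₁₁ h₁₂ h₂₁ h₂₂ : ℂ → ℝ} (hh : HasPartials h h₁ h₂)
    (hh₁ : HasPartials h₁ h₁₁ h₁₂) (hh₂ : HasPartials h₂ h₂₁ h₂₂) {y : ℂ} (hy : IsLocalMin h y)
    (v : ℂ) :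
    0 ≤ (h₁₁ y * v.re + h₁₂ y * v.im) * v.re + (h₂₁ y * v.re + h₂₂ y * v.im) * v.im := by
  have hz : h₁ y • reCLM + h₂ y • imCLM = 0 := hy.hasFDerivAt_eq_zero (hh y)
  have hz1 : h₁ y = 0 := by simpa using congrArg (fun φ : ℂ →L[ℝ] ℝ => φ 1) hz
  have hz2 : h₂ y = 0 := by simpa using congrArg (fun φ : ℂ →L[ℝ] ℝ => φ I) hz
  refine second_deriv_nonneg (k := fun t => h (y + t • v) - h y)
    (k' := fun t => h₁ (y + t • v) * v.re + h₂ (y + t • v) * v.im) (fun t => ?_) ?_ ?_ ?_ ?_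
  · exact (hh.comp_curve (hasDerivAt_line y v t)).sub_const _
  · have := ((hh₁.comp_curve (hasDerivAt_line y v 0)).mul_const v.re).fun_add
      ((hh₂.comp_curve (hasDerivAt_line y v 0)).mul_const v.im)
    simpa using this
  · simp
  · simp [hz1, hz2]
  · have hc : Tendsto (fun t : ℝ => y + t • v) (𝓝[>] 0) (𝓝 y) := by
      have : ContinuousAt (fun t : ℝ => y + t • v) 0 := (hasDerivAt_line y v 0).continuousAt
      have h2 := this.tendsto.mono_left (nhdsWithin_le_nhds (s := Ioi (0 : ℝ)))
      simpa using h2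
    filter_upwards [hc.eventually hy] with t ht
    linarith

/-- Maximum principle: a solution with boundary values in `Γ` stays in the closed ball of
radius `R₀`. -/
lemma norm_le_of_solvesGL {Γ Ω : Set ℂ} {W : ℂ → ℝ} {R₀ ε : ℝ} (hW : PotentialHyp Γ W R₀)
    (hR₀ : 0 ≤ R₀) (hΩ : IsOpen Ω) (hb : IsBounded Ω) {u : ℂ → ℂ} (hε : 0 < ε)
    (hu : SolvesGL W Ω ε u) (hbd : ∀ x ∈ frontier Ω, u x ∈ Γ) {x : ℂ} (hx : x ∈ Ω) :
    ‖u x‖ ≤ R₀ := by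
  by_contra! hcon
  obtain ⟨R, hR⟩ := hb.closure.subset_closedBall 0
  have hR0 : ‖x‖ ≤ R := by simpa using hR (subset_closure hx)
  have hRnn : 0 ≤ R := (norm_nonneg x).trans hR0
  have ha := contDiff_re hu.1
  have hb' := contDiff_im hu.1
  set a : ℂ → ℝ := fun z => (u z).re with hadef
  set b : ℂ → ℝ := fun z => (u z).im with hbdef
  have hnsq : ∀ z : ℂ, ‖z‖ ^ 2 = z.re * z.re + z.im * z.im := fun z => by
    rw [Complex.sq_norm, Complex.normSq_apply]
  have hgap : 0 < ‖u x‖ ^ 2 - R₀ ^ 2 := by nlinarith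
  obtain ⟨η, hη, hηgap⟩ : ∃ η > 0, η * R ^ 2 < ‖u x‖ ^ 2 - R₀ ^ 2 := by
    refine ⟨(‖u x‖ ^ 2 - R₀ ^ 2) / (R ^ 2 + 1), by positivity, ?_⟩
    rw [div_mul_eq_mul_div, div_lt_iff₀ (by positivity)]
    nlinarith
  let h : ℂ → ℝ := fun z => (a z * a z + b z * b z) + η * (z.re * z.re + z.im * z.im)
  have hhn : ∀ z, h z = ‖u z‖ ^ 2 + η * ‖z‖ ^ 2 := fun z => by
    simp only [h, hnsq, hadef, hbdef]
  have P := (((hasPartials ha).mul (hasPartials ha)).add ((hasPartials hb').mul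
    (hasPartials hb'))).add (((HasPartials.re.mul HasPartials.re).add
    (HasPartials.im.mul HasPartials.im)).const_mul η)
  have hcpt : IsCompact (closure Ω) := Metric.isCompact_of_isClosed_isBounded isClosed_closure
    hb.closure
  obtain ⟨y, hy, hmax⟩ := hcpt.exists_isMaxOn ⟨x, subset_closure hx⟩ P.continuous.continuousOn
  have hyx : ‖u x‖ ^ 2 ≤ ‖u y‖ ^ 2 + η * ‖y‖ ^ 2 := by
    have h1 : h x ≤ h y := hmax (subset_closure hx)
    rw [hhn, hhn] at h1
    have : 0 ≤ η * ‖x‖ ^ 2 := by positivity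
    linarith
  have hyR : ‖y‖ ≤ R := by simpa using hR hy
  have hyR2 : η * ‖y‖ ^ 2 ≤ η * R ^ 2 := by gcongr
  have huy : R₀ < ‖u y‖ := by
    have : R₀ ^ 2 < ‖u y‖ ^ 2 := by linarith
    exact lt_of_pow_lt_pow_left₀ 2 (norm_nonneg _) this
  have hyΩ : y ∈ Ω := by
    by_contra hyn
    have hyf : y ∈ frontier Ω := by rw [hΩ.frontier_eq]; exact ⟨hy, hyn⟩
    have := hW.R0_large _ (hbd y hyf)
    linarith
  have hloc : IsLocalMax h y := hmax.isLocalMax (mem_of_superset (hΩ.mem_nhds hyΩ) subset_closure)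
  have hmin : IsLocalMin (fun z => 0 * z.re - h z) y := by
    filter_upwards [hloc] with z hz
    linarith
  have Q := (HasPartials.re.const_mul 0).sub P
  have A1 := hasPartials ha
  have A2 := hasPartials_px ha
  have A3 := hasPartials_py ha
  have B1 := hasPartials hb'
  have B2 := hasPartials_px hb'
  have B3 := hasPartials_py hb'
  have one : HasPartials (fun _ => (1 : ℝ)) (fun _ => 0) (fun _ => 0) := fun z => by
    simpa using hasFDerivAt_const (1 : ℝ) z
  have zero : HasPartials (fun _ => (0 : ℝ)) (fun _ => 0) (fun _ => 0) := fun z => by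
    simpa using hasFDerivAt_const (0 : ℝ) z
  have Q1 := (one.const_mul 0).sub
    ((((A2.mul A1).add (A1.mul A2)).add ((B2.mul B1).add (B1.mul B2))).add
    ((((one.mul HasPartials.re).add (HasPartials.re.mul one)).add
      ((zero.mul HasPartials.im).add (HasPartials.im.mul zero))).const_mul η))
  have Q2 := (zero.const_mul 0).sub
    ((((A3.mul A1).add (A1.mul A3)).add ((B3.mul B1).add (B1.mul B3))).add
    ((((zero.mul HasPartials.re).add (HasPartials.re.mul zero)).add
      ((one.mul HasPartials.im).add (HasPartials.im.mul one))).const_mul η))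
  have e1 := hessian_nonneg_of_isLocalMin Q Q1 Q2 hmin 1
  have e2 := hessian_nonneg_of_isLocalMin Q Q1 Q2 hmin I
  simp only [Complex.one_re, Complex.one_im, Complex.I_re, Complex.I_im] at e1 e2
  obtain ⟨l1, l2⟩ := hu.components hyΩ
  have hco := hW.coercive (u y) huy
  rw [gradW_re, gradW_im] at hco
  have hε2 : 0 ≤ (ε ^ 2)⁻¹ * (px W (u y) * (u y).re + py W (u y) * (u y).im) := by positivity
  have l3 : a y * (px (px a) y + py (py a) y) + b y * (px (px b) y + py (py b) y) =
      (ε ^ 2)⁻¹ * (px W (u y) * (u y).re + py W (u y) * (u y).im) := by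
    rw [l1, l2]; simp only [hadef, hbdef]; ring
  nlinarith [sq_nonneg (px a y), sq_nonneg (py a y), sq_nonneg (px b y), sq_nonneg (py b y)]

lemma sq_norm_eq (z : ℂ) : ‖z‖ ^ 2 = z.re ^ 2 + z.im ^ 2 := by
  rw [Complex.sq_norm, Complex.normSq_apply]; ring

/-- The quadratic form of the Hessian of `W` at `z`. -/
def hess (W : ℂ → ℝ) (z v : ℂ) : ℝ :=
  px (px W) z * v.re ^ 2 + 2 * px (py W) z * v.re * v.im + py (py W) z * v.im ^ 2

section Potential

variable {Γ : Set ℂ} {τ : ℝ → ℂ} {W : ℂ → ℝ} {R₀ : ℝ}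

lemma ArcParam.isCompact (hΓ : ArcParam Γ τ) : IsCompact Γ := by
  have h := hΓ.periodic.image_Icc (by positivity : (0 : ℝ) < 2 * Real.pi) 0
  rw [← hΓ.srange, ← h]
  exact isCompact_Icc.image hΓ.smooth.continuous

lemma ArcParam.nonempty (hΓ : ArcParam Γ τ) : Γ.Nonempty := by
  rw [← hΓ.srange]; exact range_nonempty _

lemma PotentialHyp.eq_zero (hW : PotentialHyp Γ W R₀) {p : ℂ} (hp : p ∈ Γ) : W p = 0 := by
  rw [← hW.zeros] at hp; exact hp

lemma PotentialHyp.isLocalMin (hW : PotentialHyp Γ W R₀) {p : ℂ} (hp : p ∈ Γ) :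
    IsLocalMin W p :=
  Eventually.of_forall fun z => by rw [hW.eq_zero hp]; exact hW.nonneg z

lemma PotentialHyp.grad_eq_zero (hW : PotentialHyp Γ W R₀) {p : ℂ} (hp : p ∈ Γ) :
    px W p = 0 ∧ py W p = 0 := by
  simp [px, py, (hW.isLocalMin hp).fderiv_eq_zero]

lemma PotentialHyp.hess_nonneg (hW : PotentialHyp Γ W R₀) {p : ℂ} (hp : p ∈ Γ) (v : ℂ) :
    0 ≤ hess W p v := by
  have := hessian_nonneg_of_isLocalMin (hasPartials hW.smooth) (hasPartials_px hW.smooth)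
    (hasPartials_py hW.smooth) (hW.isLocalMin hp) v
  unfold hess
  linarith

/-- Along the segment from `p ∈ Γ` to a point whose nearest point on `Γ` is `p`, the distance to
`Γ` is the arclength. -/
lemma infDist_segment {Γ : Set ℂ} {p n : ℂ} (hp : p ∈ Γ) (hn : ‖n‖ = 1) {s₁ : ℝ}
    (hs : infDist (p + s₁ • n) Γ = s₁) {s : ℝ} (h0 : 0 ≤ s) (h1 : s ≤ s₁) :
    infDist (p + s • n) Γ = s := by
  apply le_antisymm
  · refine (infDist_le_dist_of_mem hp).trans ?_
    simp [dist_eq_norm, hn, abs_of_nonneg h0]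
  · have h := infDist_le_infDist_add_dist (s := Γ) (x := p + s₁ • n) (y := p + s • n)
    have h2 : dist (p + s₁ • n) (p + s • n) = s₁ - s := by
      rw [dist_eq_norm, show p + s₁ • n - (p + s • n) = (s₁ - s) • n by rw [sub_smul]; ring,
        norm_smul, hn, mul_one, Real.norm_of_nonneg (by linarith)]
    linarith

/-- The Hessian of `W` at a point of `Γ` controls the component normal to `Γ`. -/
lemma PotentialHyp.hess_lower_bound (hΓ : ArcParam Γ τ) (hW : PotentialHyp Γ W R₀) {μ δ : ℝ}
    (hδ : 0 < δ) (hnd : ∀ z : ℂ, infDist z Γ < δ → μ * infDist z Γ ^ 2 ≤ W z)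
    {p n : ℂ} (hp : p ∈ Γ) (hn : ‖n‖ = 1) {s₁ : ℝ} (hs₁ : 0 < s₁)
    (hs : infDist (p + s₁ • n) Γ = s₁) (v : ℂ) :
    2 * μ * (v.re * n.re + v.im * n.im) ^ 2 ≤ hess W p v := by
  obtain ⟨s₀, rfl⟩ : p ∈ range τ := by rwa [hΓ.srange]
  set T := deriv τ s₀ with hT
  have hτ : HasDerivAt τ T s₀ := (hΓ.smooth.differentiable (by simp) s₀).hasDerivAt
  have hmem : ∀ s, τ s ∈ Γ := fun s => by rw [← hΓ.srange]; exact mem_range_self s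
  have hx : px (px W) (τ s₀) * T.re + px (py W) (τ s₀) * T.im = 0 := by
    have h1 := (hasPartials_px hW.smooth).comp_curve hτ
    have h2 : (fun t => px W (τ t)) = fun _ => 0 := funext fun t => (hW.grad_eq_zero (hmem t)).1
    rw [h2] at h1
    exact h1.unique (hasDerivAt_const _ _)
  have hy : px (py W) (τ s₀) * T.re + py (py W) (τ s₀) * T.im = 0 := by
    have h1 := (hasPartials_py hW.smooth).comp_curve hτ
    have h2 : (fun t => py W (τ t)) = fun _ => 0 := funext fun t => (hW.grad_eq_zero (hmem t)).2
    rw [h2] at h1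
    exact h1.unique (hasDerivAt_const _ _)
  have hn2 : n.re ^ 2 + n.im ^ 2 = 1 := by rw [← sq_norm_eq, hn, one_pow]
  have hT2 : T.re ^ 2 + T.im ^ 2 = 1 := by rw [← sq_norm_eq, hΓ.arclength, one_pow]
  have horth : n.re * T.re + n.im * T.im = 0 := by
    set q := τ s₀ + s₁ • n with hq
    have hsq : ∀ s, ((q.re - (τ s).re) ^ 2 + (q.im - (τ s).im) ^ 2) = dist q (τ s) ^ 2 :=
      fun s => by rw [dist_eq_norm, sq_norm_eq]; simp
    have h0 : dist q (τ s₀) = s₁ := by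
      simp [hq, dist_eq_norm, hn, abs_of_pos hs₁]
    have hmin : IsLocalMin (fun s => (q.re - (τ s).re) ^ 2 + (q.im - (τ s).im) ^ 2) s₀ :=
      Eventually.of_forall fun s => by
        simp only [hsq]
        rw [h0]
        have : s₁ ≤ dist q (τ s) := hs ▸ infDist_le_dist_of_mem (hmem s)
        gcongr
    have hre : HasDerivAt (fun s => (τ s).re) T.re s₀ := by
      simpa using HasPartials.re.comp_curve hτ
    have him : HasDerivAt (fun s => (τ s).im) T.im s₀ := by
      simpa using HasPartials.im.comp_curve hτ
    have hd := hmin.hasDerivAt_eq_zero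
      (((hre.const_sub q.re).fun_pow 2).fun_add ((him.const_sub q.im).fun_pow 2))
    simp [hq] at hd
    have : s₁ * (n.re * T.re + n.im * T.im) = 0 := by linarith
    exact (mul_eq_zero.1 this).resolve_left hs₁.ne'
  have hnn : 2 * μ ≤ hess W (τ s₀) n := by
    obtain ⟨gx, gy⟩ := hW.grad_eq_zero hp
    have := second_deriv_nonneg (k := fun t => W (τ s₀ + t • n) - μ * t ^ 2)
      (k' := fun t => px W (τ s₀ + t • n) * n.re + py W (τ s₀ + t • n) * n.im - μ * (2 * t))
      (d := hess W (τ s₀) n - 2 * μ) (fun t => ?_) ?_ ?_ ?_ ?_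
    · linarith
    · refine ((hasPartials hW.smooth).comp_curve (hasDerivAt_line _ n t)).sub ?_
      simpa using ((hasDerivAt_id t).fun_pow 2).const_mul μ
    · have h1 := (((hasPartials_px hW.smooth).comp_curve (hasDerivAt_line (τ s₀) n 0)).mul_const
        n.re).fun_add (((hasPartials_py hW.smooth).comp_curve
          (hasDerivAt_line (τ s₀) n 0)).mul_const n.im)
      have h2 := h1.fun_sub (((hasDerivAt_id (0 : ℝ)).const_mul 2).const_mul μ)
      refine h2.congr_deriv ?_
      simp [hess]; ring
    · simp [hW.eq_zero hp]
    · simp [gx, gy]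
    · filter_upwards [Ioo_mem_nhdsGT (lt_min hs₁ hδ)] with s hs'
      have h1 := infDist_segment hp hn hs hs'.1.le (hs'.2.le.trans (min_le_left _ _))
      have h2 := hnd (τ s₀ + s • n) (by rw [h1]; exact hs'.2.trans_le (min_le_right _ _))
      rw [h1] at h2
      linarith
  set A := px (px W) (τ s₀)
  set B := px (py W) (τ s₀)
  set E := py (py W) (τ s₀)
  obtain ⟨κ, hκ⟩ : ∃ κ, κ = n.re * T.im - n.im * T.re := ⟨_, rfl⟩
  have hT1 : T.re = -κ * n.im := by
    rw [hκ]; linear_combination n.re * horth - T.re * hn2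
  have hT2' : T.im = κ * n.re := by
    rw [hκ]; linear_combination n.im * horth - T.im * hn2
  have hκ2 : κ ^ 2 = 1 := by
    rw [hT1, hT2'] at hT2
    linear_combination hT2 - κ ^ 2 * hn2
  have hx' : -A * n.im + B * n.re = 0 := by
    rw [hT1, hT2'] at hx
    linear_combination κ * hx - (-A * n.im + B * n.re) * hκ2
  have hy' : -B * n.im + E * n.re = 0 := by
    rw [hT1, hT2'] at hy
    linear_combination κ * hy - (-B * n.im + E * n.re) * hκ2
  obtain ⟨α, hα⟩ : ∃ α, α = v.re * n.re + v.im * n.im := ⟨_, rfl⟩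
  obtain ⟨β, hβ⟩ : ∃ β, β = -v.re * n.im + v.im * n.re := ⟨_, rfl⟩
  have hv1 : v.re = α * n.re - β * n.im := by
    rw [hα, hβ]; linear_combination -v.re * hn2
  have hv2 : v.im = α * n.im + β * n.re := by
    rw [hα, hβ]; linear_combination -v.im * hn2
  have hfin : hess W (τ s₀) v = α ^ 2 * hess W (τ s₀) n := by
    simp only [hess]
    change A * v.re ^ 2 + 2 * B * v.re * v.im + E * v.im ^ 2 =
      α ^ 2 * (A * n.re ^ 2 + 2 * B * n.re * n.im + E * n.im ^ 2)
    rw [hv1, hv2]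
    linear_combination (2 * α * β * n.re - β ^ 2 * n.im) * hx' +
      (2 * α * β * n.im + β ^ 2 * n.re) * hy'
  rw [hfin, ← hα]
  nlinarith [sq_nonneg α]

lemma exists_lipschitz_closedBall {f : ℂ → ℝ} (hf : ContDiff ℝ (⊤ : ℕ∞) f) (R : ℝ) :
    ∃ C, 0 ≤ C ∧ ∀ z ∈ closedBall (0 : ℂ) R, ∀ p ∈ closedBall (0 : ℂ) R,
      |f z - f p| ≤ C * ‖z - p‖ := by
  obtain ⟨C, hC⟩ := (isCompact_closedBall (0 : ℂ) R).exists_bound_of_continuousOn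
    (hf.continuous_fderiv (by simp)).continuousOn
  refine ⟨max C 0, le_max_right _ _, fun z hz p hp => ?_⟩
  exact (convex_closedBall (0 : ℂ) R).norm_image_sub_le_of_norm_fderiv_le
    (fun x _ => differentiable_of_smooth hf x) (fun x hx => (hC x hx).trans (le_max_left _ _)) hp hz

lemma exists_hess_lipschitz (hW : ContDiff ℝ (⊤ : ℕ∞) W) (R : ℝ) :
    ∃ C, 0 ≤ C ∧ ∀ z ∈ closedBall (0 : ℂ) R, ∀ p ∈ closedBall (0 : ℂ) R, ∀ v,
      hess W p v - C * ‖z - p‖ * ‖v‖ ^ 2 ≤ hess W z v := by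
  obtain ⟨C₁, h₁, H₁⟩ := exists_lipschitz_closedBall (contDiff_px (contDiff_px hW)) R
  obtain ⟨C₂, h₂, H₂⟩ := exists_lipschitz_closedBall (contDiff_px (contDiff_py hW)) R
  obtain ⟨C₃, h₃, H₃⟩ := exists_lipschitz_closedBall (contDiff_py (contDiff_py hW)) R
  refine ⟨C₁ + C₂ + C₃, by positivity, fun z hz p hp v => ?_⟩
  have b₁ := abs_le.1 (H₁ z hz p hp)
  have b₂ := abs_le.1 (H₂ z hz p hp)
  have b₃ := abs_le.1 (H₃ z hz p hp)
  have hd := norm_nonneg (z - p)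
  have k₁ : -(C₁ * ‖z - p‖) * ‖v‖ ^ 2 ≤ (px (px W) z - px (px W) p) * v.re ^ 2 := by
    rw [sq_norm_eq]
    nlinarith [sq_nonneg v.re, mul_nonneg (mul_nonneg h₁ hd) (sq_nonneg v.im), b₁.1]
  have k₃ : -(C₃ * ‖z - p‖) * ‖v‖ ^ 2 ≤ (py (py W) z - py (py W) p) * v.im ^ 2 := by
    rw [sq_norm_eq]
    nlinarith [sq_nonneg v.im, mul_nonneg (mul_nonneg h₃ hd) (sq_nonneg v.re), b₃.1]
  have k₂ : -(C₂ * ‖z - p‖) * ‖v‖ ^ 2 ≤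
      (px (py W) z - px (py W) p) * (2 * (v.re * v.im)) := by
    have e₁ : |2 * (v.re * v.im)| ≤ ‖v‖ ^ 2 := by
      rw [sq_norm_eq, abs_le]
      constructor <;> nlinarith [sq_nonneg (v.re + v.im), sq_nonneg (v.re - v.im)]
    have e₂ : |(px (py W) z - px (py W) p) * (2 * (v.re * v.im))| ≤ C₂ * ‖z - p‖ * ‖v‖ ^ 2 := by
      rw [abs_mul]
      exact mul_le_mul (H₂ z hz p hp) e₁ (abs_nonneg _) (by positivity)
    linarith [(abs_le.1 e₂).1]
  simp only [hess]
  nlinarith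

/-- On a ball containing `Γ`, `|∇W|²` is controlled by the squared distance to `Γ`. -/
lemma PotentialHyp.exists_grad_bound (hΓ : ArcParam Γ τ) (hW : PotentialHyp Γ W R₀) :
    ∃ C, 0 ≤ C ∧ ∀ z, ‖z‖ ≤ R₀ → px W z ^ 2 + py W z ^ 2 ≤ C * infDist z Γ ^ 2 := by
  obtain ⟨C₁, h₁, H₁⟩ := exists_lipschitz_closedBall (contDiff_px hW.smooth) R₀
  obtain ⟨C₂, h₂, H₂⟩ := exists_lipschitz_closedBall (contDiff_py hW.smooth) R₀
  refine ⟨C₁ ^ 2 + C₂ ^ 2, by positivity, fun z hz => ?_⟩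
  obtain ⟨p, hp, hd⟩ := hΓ.isCompact.exists_infDist_eq_dist hΓ.nonempty z
  have hpR : p ∈ closedBall (0 : ℂ) R₀ := by simpa using (hW.R0_large p hp).le
  have hzR : z ∈ closedBall (0 : ℂ) R₀ := by simpa using hz
  have b₁ := H₁ z hzR p hpR
  have b₂ := H₂ z hzR p hpR
  rw [(hW.grad_eq_zero hp).1, sub_zero] at b₁
  rw [(hW.grad_eq_zero hp).2, sub_zero] at b₂
  rw [hd, dist_eq_norm]
  have c₁ := pow_le_pow_left₀ (abs_nonneg _) b₁ 2
  have c₂ := pow_le_pow_left₀ (abs_nonneg _) b₂ 2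
  rw [sq_abs] at c₁ c₂
  linarith

/-- On a ball, the squared distance to `Γ` is controlled by `W`. -/
lemma PotentialHyp.exists_dist_bound (hW : PotentialHyp Γ W R₀) :
    ∃ C, 0 ≤ C ∧ ∀ z, ‖z‖ ≤ R₀ → infDist z Γ ^ 2 ≤ C * W z := by
  obtain ⟨μ, hμ, δ, hδ, hnd⟩ := hW.nondeg
  have hcD : Continuous fun z => infDist z Γ := continuous_infDist_pt Γ
  have hcpt : IsCompact (closedBall (0 : ℂ) R₀ ∩ {z | δ ≤ infDist z Γ}) :=
    (isCompact_closedBall _ _).inter_right (isClosed_le continuous_const hcD)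
  obtain ⟨C, hC⟩ := hcpt.exists_bound_of_continuousOn
    (f := fun z => infDist z Γ ^ 2 / W z) (by
      refine ((hcD.pow 2).continuousOn).div hW.smooth.continuous.continuousOn fun z hz h => ?_
      have hz0 : z ∈ Γ := by rw [← hW.zeros]; exact h
      have : δ ≤ infDist z Γ := hz.2
      rw [infDist_zero_of_mem hz0] at this
      linarith)
  refine ⟨max C 0 + 1 / μ, by positivity, fun z hz => ?_⟩
  rcases lt_or_ge (infDist z Γ) δ with h | h
  · have h1 := hnd z h
    have h2 : infDist z Γ ^ 2 ≤ 1 / μ * W z := by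
      rw [div_mul_eq_mul_div, le_div_iff₀ hμ]; linarith
    have h3 : 0 ≤ max C 0 * W z := mul_nonneg (le_max_right _ _) (hW.nonneg z)
    linarith
  · have h1 := (le_abs_self _).trans (hC z ⟨by simpa using hz, h⟩)
    have hpos : 0 < W z := by
      refine (hW.nonneg z).lt_of_ne' fun h0 => ?_
      have hz0 : z ∈ Γ := by rw [← hW.zeros]; exact h0
      rw [infDist_zero_of_mem hz0] at h
      linarith
    rw [div_le_iff₀ hpos] at h1
    have h2 : C * W z ≤ max C 0 * W z := by gcongr; exact le_max_left _ _
    have h3 : 0 ≤ 1 / μ * W z := by positivity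
    linarith

end Potential

section Pointwise

variable {Γ : Set ℂ} {τ : ℝ → ℂ} {W : ℂ → ℝ} {R₀ : ℝ} {u : ℂ → ℂ} {x : ℂ}

/-- The gradient of `h` at `x` is either zero or the component of `∇u` along a direction `n`
normal to `Γ` at a point of `Γ` nearest to `u x`. -/
def IsNormalGradient (Γ : Set ℂ) (u : ℂ → ℂ) (h : ℂ → ℝ) (x : ℂ) : Prop :=
  fderiv ℝ h x = 0 ∨ ∃ p ∈ Γ, ∃ n : ℂ, ∃ s₁ : ℝ, 0 < s₁ ∧ ‖n‖ = 1 ∧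
    infDist (p + s₁ • n) Γ = s₁ ∧ dist (u x) p = infDist (u x) Γ ∧
    ∀ v, fderiv ℝ h x v = (fderiv ℝ u x v).re * n.re + (fderiv ℝ u x v).im * n.im

lemma hasFDerivAt_sq_dist (hu : Differentiable ℝ u) (p x : ℂ) :
    HasFDerivAt (fun y => ‖u y - p‖ ^ 2)
      ((2 * ((u x).re - p.re)) • reCLM.comp (fderiv ℝ u x) +
        (2 * ((u x).im - p.im)) • imCLM.comp (fderiv ℝ u x)) x := by
  have h1 := ((reCLM.hasFDerivAt (x := u x)).comp x (hu x).hasFDerivAt).sub_const p.re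
  have h2 := ((imCLM.hasFDerivAt (x := u x)).comp x (hu x).hasFDerivAt).sub_const p.im
  have h3 := (h1.pow 2).add (h2.pow 2)
  have e : (fun y => ‖u y - p‖ ^ 2) = fun y => ((u y).re - p.re) ^ 2 + ((u y).im - p.im) ^ 2 :=
    funext fun y => by rw [sq_norm_eq]; simp
  rw [e]
  refine HasFDerivAt.congr_fderiv h3 ?_
  ext v
  simp

lemma isNormalGradient_infDist (hΓ : ArcParam Γ τ) (hu : Differentiable ℝ u) (x : ℂ) :
    IsNormalGradient Γ u (fun w => infDist (u w) Γ) x := by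
  by_cases hd : DifferentiableAt ℝ (fun w => infDist (u w) Γ) x
  swap
  · exact Or.inl (fderiv_zero_of_not_differentiableAt hd)
  rcases (infDist_nonneg (x := u x) (s := Γ)).eq_or_lt with h0 | hpos
  · left
    refine IsLocalMin.fderiv_eq_zero (Eventually.of_forall fun w => ?_)
    simp only [← h0]
    exact infDist_nonneg
  right
  obtain ⟨p, hp, hdist⟩ := hΓ.isCompact.exists_infDist_eq_dist hΓ.nonempty (u x)
  set D := infDist (u x) Γ with hD
  have hnorm : ‖u x - p‖ = D := by rw [hdist, dist_eq_norm]
  have hmin : IsLocalMin (fun y => ‖u y - p‖ ^ 2 - infDist (u y) Γ ^ 2) x :=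
    Eventually.of_forall fun y => by
      have h1 : infDist (u y) Γ ≤ ‖u y - p‖ := by
        rw [← dist_eq_norm]; exact infDist_le_dist_of_mem hp
      have h2 : infDist (u y) Γ ^ 2 ≤ ‖u y - p‖ ^ 2 := pow_le_pow_left₀ infDist_nonneg h1 2
      have h3 : ‖u x - p‖ ^ 2 - infDist (u x) Γ ^ 2 = 0 := by rw [hnorm, ← hD]; ring
      linarith
  have hz := hmin.hasFDerivAt_eq_zero
    ((hasFDerivAt_sq_dist hu p x).sub (hd.hasFDerivAt.pow 2))
  refine ⟨p, hp, D⁻¹ • (u x - p), D, hpos, ?_, ?_, hdist.symm, fun v => ?_⟩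
  · rw [norm_smul, hnorm, Real.norm_of_nonneg (by positivity), inv_mul_cancel₀ hpos.ne']
  · rw [smul_smul, mul_inv_cancel₀ hpos.ne', one_smul, add_sub_cancel]
  · have := congrArg (fun φ : ℂ →L[ℝ] ℝ => φ v) hz
    simp [← hD] at this
    simp only [Complex.smul_re, Complex.smul_im, Complex.sub_re, Complex.sub_im, smul_eq_mul]
    field_simp
    linarith

lemma isNormalGradient_norm (hΓ : Γ = sphere (0 : ℂ) 1) (hu : Differentiable ℝ u) (x : ℂ) :
    IsNormalGradient Γ u (fun w => ‖u w‖) x := by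
  by_cases hd : DifferentiableAt ℝ (fun w => ‖u w‖) x
  swap
  · exact Or.inl (fderiv_zero_of_not_differentiableAt hd)
  rcases (norm_nonneg (u x)).eq_or_lt with h0 | hpos
  · left
    refine IsLocalMin.fderiv_eq_zero (Eventually.of_forall fun w => ?_)
    simp only [← h0]
    exact norm_nonneg _
  right
  set D := ‖u x‖ with hD
  set n : ℂ := D⁻¹ • u x with hn
  have hn1 : ‖n‖ = 1 := by
    rw [norm_smul, ← hD, Real.norm_of_nonneg (by positivity), inv_mul_cancel₀ hpos.ne']
  have hux : u x = D • n := by rw [hn, smul_smul, mul_inv_cancel₀ hpos.ne', one_smul]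
  have hnΓ : n ∈ Γ := by rw [hΓ]; simpa using hn1
  have key : ∀ r : ℝ, 0 ≤ r → infDist (r • n) Γ = |r - 1| := by
    intro r hr
    apply le_antisymm
    · refine (infDist_le_dist_of_mem hnΓ).trans ?_
      rw [dist_eq_norm, show r • n - n = (r - 1) • n by rw [sub_smul, one_smul], norm_smul, hn1,
        mul_one, Real.norm_eq_abs]
    · refine (le_infDist ⟨n, hnΓ⟩).2 fun q hq => ?_
      have hq1 : ‖q‖ = 1 := by rw [hΓ] at hq; simpa using hq
      have := abs_norm_sub_norm_le (r • n) q
      rwa [norm_smul, hn1, hq1, mul_one, Real.norm_of_nonneg hr, ← dist_eq_norm] at this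
  refine ⟨n, hnΓ, n, 1, one_pos, hn1, ?_, ?_, fun v => ?_⟩
  · rw [one_smul, ← two_smul ℝ n, key 2 (by norm_num)]; norm_num
  · rw [hux, key D hpos.le, dist_eq_norm, show D • n - n = (D - 1) • n by
      rw [sub_smul, one_smul], norm_smul, hn1, mul_one, Real.norm_eq_abs]
  · have h1 := hasFDerivAt_sq_dist hu 0 x
    have h2 := hd.hasFDerivAt.pow 2
    simp only [sub_zero] at h1
    have := congrArg (fun φ : ℂ →L[ℝ] ℝ => φ v) (h1.unique h2)
    simp [← hD] at this
    simp only [hn, Complex.smul_re, Complex.smul_im, smul_eq_mul]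
    field_simp
    linarith

lemma sq_norm_clm_le (φ : ℂ →L[ℝ] ℝ) : ‖φ‖ ^ 2 ≤ φ 1 ^ 2 + φ I ^ 2 := by
  have h : ‖φ‖ ≤ √(φ 1 ^ 2 + φ I ^ 2) := by
    refine φ.opNorm_le_bound (Real.sqrt_nonneg _) fun v => ?_
    have hv : φ v = φ 1 * v.re + φ I * v.im := by
      conv_lhs => rw [clm_complex_eq φ]
      simp
    rw [Real.norm_eq_abs]
    refine abs_le_of_sq_le_sq ?_ (by positivity)
    rw [hv, mul_pow, Real.sq_sqrt (by positivity), sq_norm_eq]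
    nlinarith [sq_nonneg (φ 1 * v.im - φ I * v.re)]
  calc ‖φ‖ ^ 2 ≤ √(φ 1 ^ 2 + φ I ^ 2) ^ 2 := by gcongr
    _ = _ := Real.sq_sqrt (by positivity)

/-- Pointwise control of a normal gradient by the Hessian of `W`. -/
lemma PotentialHyp.normalGradient_le (hΓ : ArcParam Γ τ) (hW : PotentialHyp Γ W R₀) {μ δ C₀ : ℝ}
    (hδ : 0 < δ) (hμ : 0 < μ)
    (hnd : ∀ z : ℂ, infDist z Γ < δ → μ * infDist z Γ ^ 2 ≤ W z)
    (hlip : ∀ z ∈ closedBall (0 : ℂ) R₀, ∀ p ∈ closedBall (0 : ℂ) R₀, ∀ v,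
      hess W p v - C₀ * ‖z - p‖ * ‖v‖ ^ 2 ≤ hess W z v)
    {h : ℂ → ℝ} (hh : IsNormalGradient Γ u h x) (hx : ‖u x‖ ≤ R₀) :
    2 * μ * ‖fderiv ℝ h x‖ ^ 2 ≤
      hess W (u x) (fderiv ℝ u x 1) + hess W (u x) (fderiv ℝ u x I) +
        C₀ * (infDist (u x) Γ * gradSq u x) := by
  have hxR : u x ∈ closedBall (0 : ℂ) R₀ := by simpa using hx
  have hmem : ∀ p ∈ Γ, p ∈ closedBall (0 : ℂ) R₀ := fun p hp => by
    simpa using (hW.R0_large p hp).le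
  unfold gradSq
  rcases hh with h0 | ⟨p, hp, n, s₁, hs₁, hn, hs, hdist, hder⟩
  · obtain ⟨p, hp, hd⟩ := hΓ.isCompact.exists_infDist_eq_dist hΓ.nonempty (u x)
    have e₁ := hlip _ hxR p (hmem p hp) (fderiv ℝ u x 1)
    have e₂ := hlip _ hxR p (hmem p hp) (fderiv ℝ u x I)
    have f₁ := hW.hess_nonneg hp (fderiv ℝ u x 1)
    have f₂ := hW.hess_nonneg hp (fderiv ℝ u x I)
    rw [← dist_eq_norm, ← hd] at e₁ e₂
    rw [h0, norm_zero]
    linarith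
  · have e₁ := hlip _ hxR p (hmem p hp) (fderiv ℝ u x 1)
    have e₂ := hlip _ hxR p (hmem p hp) (fderiv ℝ u x I)
    have f₁ := hW.hess_lower_bound hΓ hδ hnd hp hn hs₁ hs (fderiv ℝ u x 1)
    have f₂ := hW.hess_lower_bound hΓ hδ hnd hp hn hs₁ hs (fderiv ℝ u x I)
    rw [← hder] at f₁ f₂
    rw [← dist_eq_norm, hdist] at e₁ e₂
    have := mul_le_mul_of_nonneg_left (sq_norm_clm_le (fderiv ℝ h x)) hμ.le
    linarith

end Pointwise

/-- The vector field `(P, Q)` is differentiable with continuous divergence `d`. -/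
def HasDiv (P Q d : ℂ → ℝ) : Prop :=
  ∃ P₁ P₂ Q₁ Q₂, HasPartials P P₁ P₂ ∧ HasPartials Q Q₁ Q₂ ∧ Continuous P₁ ∧ Continuous Q₂ ∧
    ∀ z, d z = P₁ z + Q₂ z

namespace HasDiv

variable {P Q d P' Q' d' : ℂ → ℝ}

lemma continuous (h : HasDiv P Q d) : Continuous d := by
  obtain ⟨P₁, P₂, Q₁, Q₂, -, -, hP, hQ, hd⟩ := h
  rw [show d = fun z => P₁ z + Q₂ z from funext hd]
  exact hP.add hQ

lemma add (h : HasDiv P Q d) (h' : HasDiv P' Q' d') :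
    HasDiv (fun z => P z + P' z) (fun z => Q z + Q' z) (fun z => d z + d' z) := by
  obtain ⟨P₁, P₂, Q₁, Q₂, hP, hQ, cP, cQ, hd⟩ := h
  obtain ⟨P₁', P₂', Q₁', Q₂', hP', hQ', cP', cQ', hd'⟩ := h'
  exact ⟨_, _, _, _, hP.add hP', hQ.add hQ', cP.add cP', cQ.add cQ', fun z => by
    simp only [hd, hd']; ring⟩

lemma const_mul (k : ℝ) (h : HasDiv P Q d) :
    HasDiv (fun z => k * P z) (fun z => k * Q z) (fun z => k * d z) := by
  obtain ⟨P₁, P₂, Q₁, Q₂, hP, hQ, cP, cQ, hd⟩ := h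
  exact ⟨_, _, _, _, hP.const_mul k, hQ.const_mul k, continuous_const.mul cP,
    continuous_const.mul cQ, fun z => by simp only [hd]; ring⟩

end HasDiv

lemma FluxBound.le_integral {Ω : Set ℂ} {γ nv : ℝ → ℂ} {L : ℝ} (hF : FluxBound Ω γ nv L)
    {P Q d : ℂ → ℝ} (h : HasDiv P Q d) {C : ℝ}
    (hC : ∀ s, -C ≤ P (γ s) * (nv s).re + Q (γ s) * (nv s).im) :
    -(C * L) ≤ ∫ z in Ω, d z := by
  obtain ⟨P₁, P₂, Q₁, Q₂, hP, hQ, cP, cQ, hd⟩ := h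
  simp only [hd]
  exact hF P P₁ P₂ Q Q₁ Q₂ hP hQ cP cQ C hC

/-- A field vanishing on the boundary has divergence of nonpositive integral. -/
lemma FluxBound.integral_nonpos {Ω : Set ℂ} {γ nv : ℝ → ℂ} {L : ℝ} (hF : FluxBound Ω γ nv L)
    {P Q d : ℂ → ℝ} (h : HasDiv P Q d) (hP : ∀ s, P (γ s) = 0) (hQ : ∀ s, Q (γ s) = 0) :
    ∫ z in Ω, d z ≤ 0 := by
  have := hF.le_integral (h.const_mul (-1)) (C := 0) fun s => by simp [hP, hQ]
  rw [integral_const_mul] at this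
  linarith

section Fields

variable {a b w W : ℂ → ℝ}

/-- The first component of the Pohozaev field `(x · ∇a) ∇a - ½ |∇a|² x`. -/
def pohozaevX (a : ℂ → ℝ) (z : ℂ) : ℝ :=
  px a z * (z.re * px a z + z.im * py a z) -
    1 / 2 * (z.re * (px a z * px a z + py a z * py a z))

/-- The second component of the Pohozaev field. -/
def pohozaevY (a : ℂ → ℝ) (z : ℂ) : ℝ :=
  py a z * (z.re * px a z + z.im * py a z) -
    1 / 2 * (z.im * (px a z * px a z + py a z * py a z))

lemma hasDiv_pohozaev (ha : ContDiff ℝ (⊤ : ℕ∞) a) :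
    HasDiv (pohozaevX a) (pohozaevY a) fun z =>
      (px (px a) z + py (py a) z) * (z.re * px a z + z.im * py a z) := by
  have A1 := hasPartials_px ha
  have A2 := hasPartials_py ha
  have c1 := A1.continuous
  have c2 := A2.continuous
  have c11 := (contDiff_px (contDiff_px ha)).continuous
  have c12 := (contDiff_px (contDiff_py ha)).continuous
  have c22 := (contDiff_py (contDiff_py ha)).continuous
  have R := (HasPartials.re.mul A1).add (HasPartials.im.mul A2)
  have N := (A1.mul A1).add (A2.mul A2)
  refine ⟨_, _, _, _, (A1.mul R).sub ((HasPartials.re.mul N).const_mul (1 / 2)),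
    (A2.mul R).sub ((HasPartials.im.mul N).const_mul (1 / 2)), ?_, ?_, fun z => ?_⟩
  · fun_prop
  · fun_prop
  · ring

lemma hasDiv_radial {f f₁ f₂ : ℂ → ℝ} (hf : HasPartials f f₁ f₂) (c1 : Continuous f₁)
    (c2 : Continuous f₂) :
    HasDiv (fun z => z.re * f z) (fun z => z.im * f z)
      fun z => 2 * f z + (z.re * f₁ z + z.im * f₂ z) := by
  have c := hf.continuous
  refine ⟨_, _, _, _, HasPartials.re.mul hf, HasPartials.im.mul hf, ?_, ?_, fun z => ?_⟩
  · fun_prop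
  · fun_prop
  · ring

/-- The first component of a field whose divergence is twice the Hessian determinant of `w`. -/
def hessDetX (w : ℂ → ℝ) (z : ℂ) : ℝ := px w z * py (py w) z - py w z * px (py w) z

/-- The second component of the field whose divergence is twice the Hessian determinant. -/
def hessDetY (w : ℂ → ℝ) (z : ℂ) : ℝ := py w z * px (px w) z - px w z * px (py w) z

lemma hasDiv_hessDet (hw : ContDiff ℝ (⊤ : ℕ∞) w) :
    HasDiv (hessDetX w) (hessDetY w) fun z =>
      2 * (px (px w) z * py (py w) z - px (py w) z ^ 2) := by
  have A1 := hasPartials_px hw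
  have A2 := hasPartials_py hw
  have A11 := hasPartials_px (contDiff_px hw)
  rw [py_px_eq hw] at A11
  have A12 := hasPartials_px (contDiff_py hw)
  have A22 := hasPartials (contDiff_py (contDiff_py hw))
  have c1 := A1.continuous
  have c2 := A2.continuous
  have c11 := A11.continuous
  have c12 := A12.continuous
  have c22 := A22.continuous
  have c112 := (contDiff_px (contDiff_px (contDiff_py hw))).continuous
  have c122 := (contDiff_px (contDiff_py (contDiff_py hw))).continuous
  refine ⟨_, _, _, _, (A1.mul A22).sub (A2.mul A12), (A2.mul A11).sub (A1.mul A12), ?_, ?_,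
    fun z => ?_⟩
  · fun_prop
  · fun_prop
  · ring

lemma hasDiv_gradCube (hw : ContDiff ℝ (⊤ : ℕ∞) w) :
    HasDiv (fun z => w z * (px w z * px w z + py w z * py w z) * px w z)
      (fun z => w z * (px w z * px w z + py w z * py w z) * py w z) fun z =>
      (px w z ^ 2 + py w z ^ 2) ^ 2 +
        w z * ((px w z ^ 2 + py w z ^ 2) * (px (px w) z + py (py w) z) +
          2 * (px (px w) z * px w z ^ 2 + 2 * px (py w) z * px w z * py w z +
            py (py w) z * py w z ^ 2)) := by
  have A := hasPartials hw
  have A1 := hasPartials_px hw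
  have A2 := hasPartials_py hw
  have c := A.continuous
  have c1 := A1.continuous
  have c2 := A2.continuous
  have c11 := (contDiff_px (contDiff_px hw)).continuous
  have c12 := (contDiff_px (contDiff_py hw)).continuous
  have c22 := (contDiff_py (contDiff_py hw)).continuous
  have N := A.mul ((A1.mul A1).add (A2.mul A2))
  refine ⟨_, _, _, _, N.mul A1, N.mul A2, ?_, ?_, fun z => ?_⟩
  · fun_prop
  · fun_prop
  · ring

end Fields

section Composite

variable {W : ℂ → ℝ} {u : ℂ → ℂ}

lemma hasPartials_comp (hW : ContDiff ℝ (⊤ : ℕ∞) W) (hu : ContDiff ℝ (⊤ : ℕ∞) u) :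
    HasPartials (fun z => W (u z))
      (fun z => px W (u z) * px (fun y => (u y).re) z + py W (u z) * px (fun y => (u y).im) z)
      (fun z => px W (u z) * py (fun y => (u y).re) z + py W (u z) * py (fun y => (u y).im) z) :=
  (hasPartials hW).comp_map (hasPartials (contDiff_re hu)) (hasPartials (contDiff_im hu))

lemma hasDiv_gradComp (hW : ContDiff ℝ (⊤ : ℕ∞) W) (hu : ContDiff ℝ (⊤ : ℕ∞) u) :
    HasDiv
      (fun z => px W (u z) * px (fun y => (u y).re) z + py W (u z) * px (fun y => (u y).im) z)
      (fun z => px W (u z) * py (fun y => (u y).re) z + py W (u z) * py (fun y => (u y).im) z)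
      fun z => hess W (u z) (fderiv ℝ u z 1) + hess W (u z) (fderiv ℝ u z I) +
        (px W (u z) * (px (px fun y => (u y).re) z + py (py fun y => (u y).re) z) +
          py W (u z) * (px (px fun y => (u y).im) z + py (py fun y => (u y).im) z)) := by
  have ha := contDiff_re hu
  have hb := contDiff_im hu
  have cu := hu.continuous
  have U1 := (hasPartials_px hW).comp_map (hasPartials ha) (hasPartials hb)
  have U2 := (hasPartials_py hW).comp_map (hasPartials ha) (hasPartials hb)
  have d := differentiable_of_smooth hu
  have e1 : ∀ z, (fderiv ℝ u z 1).re = px (fun y => (u y).re) z := fun z => (fderiv_re d z 1).symm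
  have e2 : ∀ z, (fderiv ℝ u z 1).im = px (fun y => (u y).im) z := fun z => (fderiv_im d z 1).symm
  have e3 : ∀ z, (fderiv ℝ u z I).re = py (fun y => (u y).re) z := fun z => (fderiv_re d z I).symm
  have e4 : ∀ z, (fderiv ℝ u z I).im = py (fun y => (u y).im) z := fun z => (fderiv_im d z I).symm
  have k1 := (contDiff_px hW).continuous
  have k2 := (contDiff_py hW).continuous
  have k11 := (contDiff_px (contDiff_px hW)).continuous
  have k12 := (contDiff_px (contDiff_py hW)).continuous
  have k22 := (contDiff_py (contDiff_py hW)).continuous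
  simp only [hess, e1, e2, e3, e4]
  have A1 := hasPartials_px ha
  have A2 := hasPartials_py ha
  have B1 := hasPartials_px hb
  have B2 := hasPartials_py hb
  have a1 := A1.continuous
  have a2 := A2.continuous
  have b1 := B1.continuous
  have b2 := B2.continuous
  have a11 := (contDiff_px (contDiff_px ha)).continuous
  have a22 := (contDiff_py (contDiff_py ha)).continuous
  have b11 := (contDiff_px (contDiff_px hb)).continuous
  have b22 := (contDiff_py (contDiff_py hb)).continuous
  refine ⟨_, _, _, _, (U1.mul A1).add (U2.mul B1), (U1.mul A2).add (U2.mul B2), ?_, ?_,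
    fun z => ?_⟩
  · fun_prop
  · fun_prop
  · ring

end Composite

section BoundaryFlux

/-- A vector orthogonal to the unit vector `t` of an orthonormal frame `(n, t)`. -/
lemma frame_relations {n t : ℂ} (hn : ‖n‖ = 1) (ht : ‖t‖ = 1)
    (h : n.re * t.re + n.im * t.im = 0) :
    ∃ κ : ℝ, κ ^ 2 = 1 ∧ t.re = -κ * n.im ∧ t.im = κ * n.re := by
  have hn2 : n.re ^ 2 + n.im ^ 2 = 1 := by rw [← sq_norm_eq, hn, one_pow]
  have ht2 : t.re ^ 2 + t.im ^ 2 = 1 := by rw [← sq_norm_eq, ht, one_pow]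
  refine ⟨n.re * t.im - n.im * t.re, ?_, ?_, ?_⟩
  · linear_combination (n.re ^ 2 + n.im ^ 2) * ht2 + hn2 - (n.re * t.re + n.im * t.im) * h
  · linear_combination n.re * h - t.re * hn2
  · linear_combination n.im * h - t.im * hn2

/-- Lower bound for the boundary flux of the Pohozaev field. -/
lemma pohozaev_flux_bound {x n t : ℂ} {a₁ a₂ g₁ g₂ c M G : ℝ} (hn : ‖n‖ = 1) (ht : ‖t‖ = 1)
    (hnt : n.re * t.re + n.im * t.im = 0) (hc : 0 < c) (hx : ‖x‖ ≤ M)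
    (hs : c ≤ x.re * n.re + x.im * n.im)
    (htan : (a₁ - g₁) * t.re + (a₂ - g₂) * t.im = 0) (hG : g₁ ^ 2 + g₂ ^ 2 ≤ G ^ 2) :
    c / 4 * (a₁ * n.re + a₂ * n.im) ^ 2 - (M / 2 + M ^ 2 / c) * G ^ 2 ≤
      (a₁ * (x.re * a₁ + x.im * a₂) - 1 / 2 * (x.re * (a₁ * a₁ + a₂ * a₂))) * n.re +
      (a₂ * (x.re * a₁ + x.im * a₂) - 1 / 2 * (x.im * (a₁ * a₁ + a₂ * a₂))) * n.im := by
  obtain ⟨κ, hκ, t1, t2⟩ := frame_relations hn ht hnt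
  have hn2 : n.re ^ 2 + n.im ^ 2 = 1 := by rw [← sq_norm_eq, hn, one_pow]
  have hM : 0 ≤ M := (norm_nonneg x).trans hx
  have hxM : x.re ^ 2 + x.im ^ 2 ≤ M ^ 2 := by
    rw [← sq_norm_eq]; exact pow_le_pow_left₀ (norm_nonneg x) hx 2
  have htan' : -(a₁ - g₁) * n.im + (a₂ - g₂) * n.re = 0 := by
    rw [t1, t2] at htan
    linear_combination κ * htan - (-(a₁ - g₁) * n.im + (a₂ - g₂) * n.re) * hκ
  obtain ⟨p, hp⟩ : ∃ p, p = a₁ * n.re + a₂ * n.im := ⟨_, rfl⟩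
  obtain ⟨q, hq⟩ : ∃ q, q = -a₁ * n.im + a₂ * n.re := ⟨_, rfl⟩
  obtain ⟨X, hX⟩ : ∃ X, X = x.re * n.re + x.im * n.im := ⟨_, rfl⟩
  obtain ⟨Y, hY⟩ : ∃ Y, Y = -x.re * n.im + x.im * n.re := ⟨_, rfl⟩
  have hqG : q ^ 2 ≤ G ^ 2 := by
    have e : q = -g₁ * n.im + g₂ * n.re := by rw [hq]; linear_combination htan'
    have : q ^ 2 + (g₁ * n.re + g₂ * n.im) ^ 2 = g₁ ^ 2 + g₂ ^ 2 := by
      rw [e]; linear_combination (g₁ ^ 2 + g₂ ^ 2) * hn2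
    linarith [sq_nonneg (g₁ * n.re + g₂ * n.im)]
  have hXY : X ^ 2 + Y ^ 2 ≤ M ^ 2 := by
    have : X ^ 2 + Y ^ 2 = x.re ^ 2 + x.im ^ 2 := by
      rw [hX, hY]; linear_combination (x.re ^ 2 + x.im ^ 2) * hn2
    linarith
  have ea1 : a₁ = p * n.re - q * n.im := by rw [hp, hq]; linear_combination -a₁ * hn2
  have ea2 : a₂ = p * n.im + q * n.re := by rw [hp, hq]; linear_combination -a₂ * hn2
  have ex1 : x.re = X * n.re - Y * n.im := by rw [hX, hY]; linear_combination -x.re * hn2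
  have ex2 : x.im = X * n.im + Y * n.re := by rw [hX, hY]; linear_combination -x.im * hn2
  have hsum : a₁ * a₁ + a₂ * a₂ = p ^ 2 + q ^ 2 := by
    rw [ea1, ea2]; linear_combination (p ^ 2 + q ^ 2) * hn2
  have hdot : x.re * a₁ + x.im * a₂ = X * p + Y * q := by
    rw [ea1, ea2, ex1, ex2]; linear_combination (X * p + Y * q) * hn2
  have hflux : (a₁ * (x.re * a₁ + x.im * a₂) - 1 / 2 * (x.re * (a₁ * a₁ + a₂ * a₂))) * n.re +
      (a₂ * (x.re * a₁ + x.im * a₂) - 1 / 2 * (x.im * (a₁ * a₁ + a₂ * a₂))) * n.im =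
      X * p ^ 2 / 2 + Y * p * q - X * q ^ 2 / 2 := by
    rw [hsum, hdot]
    linear_combination -(X * p + Y * q) * hp + (p ^ 2 + q ^ 2) / 2 * hX
  rw [hflux, ← hp]
  have hXM : X ≤ M := le_of_abs_le (abs_le_of_sq_le_sq (by linarith [sq_nonneg Y]) hM)
  have hX' : c ≤ X := hX ▸ hs
  have hYM : Y ^ 2 ≤ M ^ 2 := by linarith [sq_nonneg X]
  have h1 : c * (p ^ 2 / 4) + Y * p * q + M ^ 2 / c * q ^ 2 ≥ 0 := by
    have e : c * (p ^ 2 / 4) + Y * p * q + M ^ 2 / c * q ^ 2 =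
        ((c * p / 2 + Y * q) ^ 2 + (M ^ 2 - Y ^ 2) * q ^ 2) / c := by field_simp; ring
    rw [e]
    have := mul_nonneg (sub_nonneg.2 hYM) (sq_nonneg q)
    positivity
  have h2 : M ^ 2 / c * q ^ 2 ≤ M ^ 2 / c * G ^ 2 := by gcongr
  have h3 : X * q ^ 2 ≤ M * G ^ 2 := by
    calc X * q ^ 2 ≤ M * q ^ 2 := by gcongr
      _ ≤ _ := by gcongr
  have h4 : c * p ^ 2 ≤ X * p ^ 2 := by gcongr
  linarith

/-- Lower bound for the boundary flux of the Hessian determinant field of a function `w`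
vanishing on the boundary. -/
lemma hessDet_flux_bound {n t t' : ℂ} {a₁ a₂ g₁ g₂ w₁₁ w₁₂ w₂₂ K G : ℝ} (hn : ‖n‖ = 1)
    (ht : ‖t‖ = 1) (hnt : n.re * t.re + n.im * t.im = 0) (hK : ‖t'‖ ≤ K)
    (htan : (a₁ - g₁) * t.re + (a₂ - g₂) * t.im = 0) (hG : g₁ ^ 2 + g₂ ^ 2 ≤ G ^ 2)
    (hsec : w₁₁ * t.re ^ 2 + 2 * w₁₂ * t.re * t.im + w₂₂ * t.im ^ 2 +
      ((a₁ - g₁) * t'.re + (a₂ - g₂) * t'.im) = 0) :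
    -(2 * K) * (a₁ * n.re + a₂ * n.im) ^ 2 - 2 * K * G ^ 2 ≤
      ((a₁ - g₁) * w₂₂ - (a₂ - g₂) * w₁₂) * n.re + ((a₂ - g₂) * w₁₁ - (a₁ - g₁) * w₁₂) * n.im := by
  obtain ⟨κ, hκ, t1, t2⟩ := frame_relations hn ht hnt
  have hn2 : n.re ^ 2 + n.im ^ 2 = 1 := by rw [← sq_norm_eq, hn, one_pow]
  have hK0 : 0 ≤ K := (norm_nonneg _).trans hK
  have htan' : -(a₁ - g₁) * n.im + (a₂ - g₂) * n.re = 0 := by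
    rw [t1, t2] at htan
    linear_combination κ * htan - (-(a₁ - g₁) * n.im + (a₂ - g₂) * n.re) * hκ
  obtain ⟨p, hp⟩ : ∃ p, p = (a₁ - g₁) * n.re + (a₂ - g₂) * n.im := ⟨_, rfl⟩
  have e1 : a₁ - g₁ = p * n.re := by
    rw [hp]; linear_combination -(a₁ - g₁) * hn2 - n.im * htan'
  have e2 : a₂ - g₂ = p * n.im := by
    rw [hp]; linear_combination -(a₂ - g₂) * hn2 + n.re * htan'
  have hsec' : w₁₁ * n.im ^ 2 - 2 * w₁₂ * n.re * n.im + w₂₂ * n.re ^ 2 =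
      -(p * (n.re * t'.re + n.im * t'.im)) := by
    rw [e1, e2, t1, t2] at hsec
    linear_combination hsec -
      (w₁₁ * n.im ^ 2 - 2 * w₁₂ * n.re * n.im + w₂₂ * n.re ^ 2) * hκ
  rw [e1, e2]
  have hflux : (p * n.re * w₂₂ - p * n.im * w₁₂) * n.re +
      (p * n.im * w₁₁ - p * n.re * w₁₂) * n.im = -(p ^ 2 * (n.re * t'.re + n.im * t'.im)) := by
    linear_combination p * hsec'
  rw [hflux]
  have hdot : n.re * t'.re + n.im * t'.im ≤ K := by
    refine le_of_abs_le (abs_le_of_sq_le_sq ?_ hK0)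
    have h1 : t'.re ^ 2 + t'.im ^ 2 ≤ K ^ 2 := by
      rw [← sq_norm_eq]; exact pow_le_pow_left₀ (norm_nonneg _) hK 2
    have h2 : (n.re * t'.re + n.im * t'.im) ^ 2 + (n.re * t'.im - n.im * t'.re) ^ 2 =
        t'.re ^ 2 + t'.im ^ 2 := by linear_combination (t'.re ^ 2 + t'.im ^ 2) * hn2
    linarith [sq_nonneg (n.re * t'.im - n.im * t'.re)]
  have hpb : p ^ 2 ≤ 2 * (a₁ * n.re + a₂ * n.im) ^ 2 + 2 * G ^ 2 := by
    have h1 : (g₁ * n.re + g₂ * n.im) ^ 2 ≤ G ^ 2 := by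
      have : (g₁ * n.re + g₂ * n.im) ^ 2 + (g₁ * n.im - g₂ * n.re) ^ 2 = g₁ ^ 2 + g₂ ^ 2 := by
        linear_combination (g₁ ^ 2 + g₂ ^ 2) * hn2
      linarith [sq_nonneg (g₁ * n.im - g₂ * n.re)]
    have h2 : p = (a₁ * n.re + a₂ * n.im) - (g₁ * n.re + g₂ * n.im) := by rw [hp]; ring
    rw [h2]
    linarith [sq_nonneg ((a₁ * n.re + a₂ * n.im) + (g₁ * n.re + g₂ * n.im))]
  linarith [mul_le_mul_of_nonneg_left hdot (sq_nonneg p), mul_le_mul_of_nonneg_left hpb hK0]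

end BoundaryFlux

/-- First and second derivative along a curve on which a smooth function vanishes. -/
lemma curve_derivatives_eq_zero {w : ℂ → ℝ} (hw : ContDiff ℝ (⊤ : ℕ∞) w) {γ : ℝ → ℂ}
    (hγ : ContDiff ℝ (⊤ : ℕ∞) γ) (h0 : ∀ s, w (γ s) = 0) (s : ℝ) :
    px w (γ s) * (deriv γ s).re + py w (γ s) * (deriv γ s).im = 0 ∧
    px (px w) (γ s) * (deriv γ s).re ^ 2 +
      2 * px (py w) (γ s) * (deriv γ s).re * (deriv γ s).im +
      py (py w) (γ s) * (deriv γ s).im ^ 2 +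
      (px w (γ s) * (deriv (deriv γ) s).re + py w (γ s) * (deriv (deriv γ) s).im) = 0 := by
  have hγ2 : ContDiff ℝ (1 + 1) γ := by exact_mod_cast contDiff_infty.1 hγ 2
  have hγ1 : ContDiff ℝ 1 (deriv γ) := (contDiff_succ_iff_deriv.1 hγ2).2.2
  have d1 : ∀ s, HasDerivAt γ (deriv γ s) s := fun s =>
    (hγ.differentiable (by simp) s).hasDerivAt
  have d2 : ∀ s, HasDerivAt (deriv γ) (deriv (deriv γ) s) s := fun s =>
    (hγ1.differentiable (by norm_num) s).hasDerivAt
  have first : ∀ s, px w (γ s) * (deriv γ s).re + py w (γ s) * (deriv γ s).im = 0 := fun s => by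
    have h1 := (hasPartials hw).comp_curve (d1 s)
    simp only [h0] at h1
    exact h1.unique (hasDerivAt_const _ _)
  refine ⟨first s, ?_⟩
  have hre : HasDerivAt (fun s => (deriv γ s).re) (deriv (deriv γ) s).re s := by
    simpa using HasPartials.re.comp_curve (d2 s)
  have him : HasDerivAt (fun s => (deriv γ s).im) (deriv (deriv γ) s).im s := by
    simpa using HasPartials.im.comp_curve (d2 s)
  have h2 := (((hasPartials_px hw).comp_curve (d1 s)).fun_mul hre).fun_add
    (((hasPartials_py hw).comp_curve (d1 s)).fun_mul him)
  simp only [first] at h2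
  have := h2.unique (hasDerivAt_const _ _)
  linear_combination this

lemma Continuous.integrableOn_of_isBounded {Ω : Set ℂ} (hb : IsBounded Ω) {f : ℂ → ℝ}
    (hf : Continuous f) : IntegrableOn f Ω :=
  (hf.continuousOn.integrableOn_compact hb.isCompact_closure).mono_set subset_closure

lemma setIntegral_mono_of_continuous {Ω : Set ℂ} (hΩ : IsOpen Ω) (hb : IsBounded Ω) {f g : ℂ → ℝ}
    (hf : Continuous f) (hg : Continuous g) (h : ∀ z ∈ Ω, f z ≤ g z) :
    ∫ z in Ω, f z ≤ ∫ z in Ω, g z :=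
  setIntegral_mono_on (hf.integrableOn_of_isBounded hb) (hg.integrableOn_of_isBounded hb)
    hΩ.measurableSet h

lemma setIntegral_linear_combination {Ω : Set ℂ} (hb : IsBounded Ω) (k l : ℝ) {f g : ℂ → ℝ}
    (hf : Continuous f) (hg : Continuous g) :
    ∫ z in Ω, (k * f z + l * g z) = k * (∫ z in Ω, f z) + l * ∫ z in Ω, g z := by
  rw [integral_add ((hf.integrableOn_of_isBounded hb).const_mul k)
    ((hg.integrableOn_of_isBounded hb).const_mul l), integral_const_mul, integral_const_mul]

/-- `|∇f|²`. -/
def gradNormSq (f : ℂ → ℝ) (z : ℂ) : ℝ := px f z ^ 2 + py f z ^ 2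

/-- `|D²f|²`. -/
def hessNormSq (f : ℂ → ℝ) (z : ℂ) : ℝ :=
  px (px f) z ^ 2 + 2 * px (py f) z ^ 2 + py (py f) z ^ 2

lemma lapR_eq (f : ℂ → ℝ) (z : ℂ) : lapR f z = px (px f) z + py (py f) z := rfl

section Continuity

variable {f : ℂ → ℝ}

lemma continuous_gradNormSq (hf : ContDiff ℝ (⊤ : ℕ∞) f) : Continuous (gradNormSq f) :=
  ((contDiff_px hf).continuous.pow 2).add ((contDiff_py hf).continuous.pow 2)

lemma continuous_hessNormSq (hf : ContDiff ℝ (⊤ : ℕ∞) f) : Continuous (hessNormSq f) :=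
  (((contDiff_px (contDiff_px hf)).continuous.pow 2).add
    (continuous_const.mul ((contDiff_px (contDiff_py hf)).continuous.pow 2))).add
    ((contDiff_py (contDiff_py hf)).continuous.pow 2)

lemma continuous_lapR (hf : ContDiff ℝ (⊤ : ℕ∞) f) : Continuous (lapR f) :=
  (contDiff_px (contDiff_px hf)).continuous.add (contDiff_py (contDiff_py hf)).continuous

variable {g : ℂ → ℝ}

lemma px_sub (hf : ContDiff ℝ (⊤ : ℕ∞) f) (hg : ContDiff ℝ (⊤ : ℕ∞) g) :
    px (fun z => f z - g z) = fun z => px f z - px g z := by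
  ext z
  simp [px, fderiv_fun_sub (differentiable_of_smooth hf z) (differentiable_of_smooth hg z)]

lemma py_sub (hf : ContDiff ℝ (⊤ : ℕ∞) f) (hg : ContDiff ℝ (⊤ : ℕ∞) g) :
    py (fun z => f z - g z) = fun z => py f z - py g z := by
  ext z
  simp [py, fderiv_fun_sub (differentiable_of_smooth hf z) (differentiable_of_smooth hg z)]

lemma lapR_sub (hf : ContDiff ℝ (⊤ : ℕ∞) f) (hg : ContDiff ℝ (⊤ : ℕ∞) g) (z : ℂ) :
    lapR (fun z => f z - g z) z = lapR f z - lapR g z := by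
  rw [lapR_eq, px_sub hf hg, py_sub hf hg, px_sub (contDiff_px hf) (contDiff_px hg),
    py_sub (contDiff_py hf) (contDiff_py hg), lapR_eq, lapR_eq]
  ring

end Continuity

/-- A Gagliardo–Nirenberg type inequality: `∫ |∇w|⁴ ≤ 16 B² ∫ |D²w|²` when `|w| ≤ B` and `w`
vanishes on the boundary. -/
lemma FluxBound.gradient_four_bound {Ω : Set ℂ} {γ nv : ℝ → ℂ} {L B : ℝ}
    (hF : FluxBound Ω γ nv L) (hΩ : IsOpen Ω) (hb : IsBounded Ω) {w : ℂ → ℝ}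
    (hw : ContDiff ℝ (⊤ : ℕ∞) w) (h0 : ∀ s, w (γ s) = 0) (hB : ∀ z ∈ Ω, w z ^ 2 ≤ B ^ 2) :
    ∫ z in Ω, gradNormSq w z ^ 2 ≤ 16 * B ^ 2 * ∫ z in Ω, hessNormSq w z := by
  have hdiv := hasDiv_gradCube hw
  have h1 := hF.integral_nonpos hdiv (by simp [h0]) (by simp [h0])
  have cd := hdiv.continuous
  have cg := continuous_gradNormSq hw
  have ch := continuous_hessNormSq hw
  have h2 : (∫ z in Ω, gradNormSq w z ^ 2) ≤ ∫ z in Ω, (2 * ((px w z ^ 2 + py w z ^ 2) ^ 2 +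
        w z * ((px w z ^ 2 + py w z ^ 2) * (px (px w) z + py (py w) z) +
          2 * (px (px w) z * px w z ^ 2 + 2 * px (py w) z * px w z * py w z +
            py (py w) z * py w z ^ 2))) + 16 * B ^ 2 * hessNormSq w z) :=
    setIntegral_mono_of_continuous hΩ hb (by fun_prop) (by fun_prop) fun z hz => ?_
  · rw [setIntegral_linear_combination hb 2 (16 * B ^ 2) cd ch] at h2
    linarith
  simp only [gradNormSq, hessNormSq]
  have hBz := hB z hz
  generalize w z = w₀ at *
  generalize px w z = w₁
  generalize py w z = w₂
  generalize px (px w) z = w₁₁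
  generalize px (py w) z = w₁₂
  generalize py (py w) z = w₂₂
  obtain ⟨S, hS⟩ : ∃ S, S = w₁ ^ 2 + w₂ ^ 2 := ⟨_, rfl⟩
  obtain ⟨H, hH⟩ : ∃ H, H = w₁₁ ^ 2 + 2 * w₁₂ ^ 2 + w₂₂ ^ 2 := ⟨_, rfl⟩
  obtain ⟨q, hq⟩ : ∃ q, q = w₁₁ * w₁ ^ 2 + 2 * w₁₂ * w₁ * w₂ + w₂₂ * w₂ ^ 2 := ⟨_, rfl⟩
  rw [← hS, ← hH, ← hq]
  have hH0 : 0 ≤ H := by rw [hH]; positivity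
  have hq2 : q ^ 2 ≤ S ^ 2 * H := by
    have e : S ^ 2 * H - q ^ 2 = 2 * (w₁₁ * (w₁ * w₂) - w₁₂ * w₁ ^ 2) ^ 2 +
        (w₁₁ * w₂ ^ 2 - w₂₂ * w₁ ^ 2) ^ 2 + 2 * (w₁₂ * w₂ ^ 2 - w₂₂ * (w₁ * w₂)) ^ 2 := by
      rw [hS, hH, hq]; ring
    have : 0 ≤ S ^ 2 * H - q ^ 2 := by rw [e]; positivity
    linarith
  have hlap : (w₁₁ + w₂₂) ^ 2 ≤ 2 * H := by
    rw [hH]; linarith [sq_nonneg (w₁₁ - w₂₂), sq_nonneg w₁₂]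
  obtain ⟨E, hE⟩ : ∃ E, E = S * (w₁₁ + w₂₂) + 2 * q := ⟨_, rfl⟩
  rw [← hE]
  have hE2 : E ^ 2 ≤ 16 * (S ^ 2 * H) := by
    have h3 : E ^ 2 ≤ 2 * (S ^ 2 * (w₁₁ + w₂₂) ^ 2) + 8 * q ^ 2 := by
      rw [hE]; linarith [sq_nonneg (S * (w₁₁ + w₂₂) - 2 * q)]
    have h4 := mul_le_mul_of_nonneg_left hlap (sq_nonneg S)
    have h5 : 0 ≤ S ^ 2 * H := by positivity
    linarith
  have hwE : |2 * (w₀ * E)| ≤ S ^ 2 + 16 * B ^ 2 * H := by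
    refine abs_le_of_sq_le_sq ?_ (by positivity)
    have h3 : w₀ ^ 2 * E ^ 2 ≤ B ^ 2 * (16 * (S ^ 2 * H)) :=
      mul_le_mul hBz hE2 (sq_nonneg _) (sq_nonneg _)
    linarith [sq_nonneg (S ^ 2 - 16 * B ^ 2 * H)]
  linarith [(abs_le.1 hwE).1]

/-- A bounded domain, strictly star-shaped about the origin, with a smooth boundary curve `γ`
and normal field `nv`. -/
structure StarDomain (Ω : Set ℂ) (γ nv : ℝ → ℂ) (L c M K : ℝ) : Prop where
  isOpen : IsOpen Ω
  isBounded : IsBounded Ω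
  flux : FluxBound Ω γ nv L
  smooth : ContDiff ℝ (⊤ : ℕ∞) γ
  mem_frontier : ∀ s, γ s ∈ frontier Ω
  unit_normal : ∀ s, ‖nv s‖ = 1
  unit_tangent : ∀ s, ‖deriv γ s‖ = 1
  orth : ∀ s, (nv s).re * (deriv γ s).re + (nv s).im * (deriv γ s).im = 0
  cpos : 0 < c
  star : ∀ s, c ≤ (γ s).re * (nv s).re + (γ s).im * (nv s).im
  norm_le : ∀ s, ‖γ s‖ ≤ M
  curvature_le : ∀ s, ‖deriv (deriv γ) s‖ ≤ K

section Estimates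

variable {Ω : Set ℂ} {γ nv : ℝ → ℂ} {L c M K G : ℝ}

/-- Boundary flux bounds for one component `a` with boundary datum `a₀`. -/
lemma StarDomain.flux_bounds (hD : StarDomain Ω γ nv L c M K) {a a₀ : ℂ → ℝ}
    (ha : ContDiff ℝ (⊤ : ℕ∞) a) (ha₀ : ContDiff ℝ (⊤ : ℕ∞) a₀)
    (hbd : ∀ s, a (γ s) = a₀ (γ s)) (hG : ∀ s, gradNormSq a₀ (γ s) ≤ G ^ 2) (s : ℝ) :
    ∃ p : ℝ, 0 ≤ p ∧
    c / 4 * p - (M / 2 + M ^ 2 / c) * G ^ 2 ≤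
      pohozaevX a (γ s) * (nv s).re + pohozaevY a (γ s) * (nv s).im ∧
    -(2 * K) * p - 2 * K * G ^ 2 ≤
      hessDetX (fun z => a z - a₀ z) (γ s) * (nv s).re +
        hessDetY (fun z => a z - a₀ z) (γ s) * (nv s).im := by
  obtain ⟨h1, h2⟩ := curve_derivatives_eq_zero (ha.sub ha₀) hD.smooth
    (fun s => by rw [hbd, sub_self]) s
  have e1 : ∀ z, px (fun z => a z - a₀ z) z = px a z - px a₀ z := fun z => by
    rw [px_sub ha ha₀]
  have e2 : ∀ z, py (fun z => a z - a₀ z) z = py a z - py a₀ z := fun z => by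
    rw [py_sub ha ha₀]
  rw [e1 (γ s), e2 (γ s)] at h1 h2
  refine ⟨(px a (γ s) * (nv s).re + py a (γ s) * (nv s).im) ^ 2, sq_nonneg _,
    pohozaev_flux_bound (hD.unit_normal s) (hD.unit_tangent s) (hD.orth s) hD.cpos (hD.norm_le s)
      (hD.star s) h1 (hG s), ?_⟩
  unfold hessDetX hessDetY
  rw [e1 (γ s), e2 (γ s)]
  exact hessDet_flux_bound (hD.unit_normal s) (hD.unit_tangent s) (hD.orth s)
    (hD.curvature_le s) h1 (hG s) h2

variable {Γ : Set ℂ} {W : ℂ → ℝ} {R₀ ε : ℝ} {u g : ℂ → ℂ}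

/-- The Pohozaev field of a solution `u` has divergence `-2 ε⁻² W(u)`. -/
lemma hasDiv_pohozaev_solution (hW : ContDiff ℝ (⊤ : ℕ∞) W) (hu : SolvesGL W Ω ε u) :
    ∃ d : ℂ → ℝ, HasDiv
      (fun z => (pohozaevX (fun y => (u y).re) z + pohozaevX (fun y => (u y).im) z) +
        -(ε ^ 2)⁻¹ * (z.re * W (u z)))
      (fun z => (pohozaevY (fun y => (u y).re) z + pohozaevY (fun y => (u y).im) z) +
        -(ε ^ 2)⁻¹ * (z.im * W (u z))) d ∧
      ∀ z ∈ Ω, d z = -(2 * (ε ^ 2)⁻¹ * W (u z)) := by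
  have ha := contDiff_re hu.1
  have hb := contDiff_im hu.1
  have c1 := (contDiff_px hW).continuous.comp hu.1.continuous
  have c2 := (contDiff_py hW).continuous.comp hu.1.continuous
  have a1 := (contDiff_px ha).continuous
  have a2 := (contDiff_py ha).continuous
  have b1 := (contDiff_px hb).continuous
  have b2 := (contDiff_py hb).continuous
  refine ⟨_, ((hasDiv_pohozaev ha).add (hasDiv_pohozaev hb)).add
    ((hasDiv_radial (hasPartials_comp hW hu.1) ((c1.mul a1).add (c2.mul b1))
      ((c1.mul a2).add (c2.mul b2))).const_mul (-(ε ^ 2)⁻¹)), fun z hz => ?_⟩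
  obtain ⟨l1, l2⟩ := hu.components hz
  simp only [l1, l2]
  ring

/-- Pohozaev bound for the potential energy, and the bound for the second derivatives. -/
lemma StarDomain.energy_and_hessian_bound (hD : StarDomain Ω γ nv L c M K)
    (hW : PotentialHyp Γ W R₀) (hε : 0 < ε) (hu : SolvesGL W Ω ε u)
    (hbd : ∀ x ∈ frontier Ω, u x = g x) (hg : ContDiff ℝ (⊤ : ℕ∞) g)
    (hgΓ : ∀ x ∈ frontier Ω, g x ∈ Γ)
    (hG₁ : ∀ s, gradNormSq (fun y => (g y).re) (γ s) ≤ G ^ 2)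
    (hG₂ : ∀ s, gradNormSq (fun y => (g y).im) (γ s) ≤ G ^ 2) :
    (∫ z in Ω, W (u z)) ≤ ε ^ 2 * ((M / 2 + M ^ 2 / c) * G ^ 2 * L) ∧
    (∫ z in Ω, (hessNormSq (fun y => (u y).re - (g y).re) z +
        hessNormSq (fun y => (u y).im - (g y).im) z)) ≤
      (∫ z in Ω, (lapR (fun y => (u y).re - (g y).re) z ^ 2 +
        lapR (fun y => (u y).im - (g y).im) z ^ 2)) +
      2 * (8 * K / c * (M / 2 + M ^ 2 / c) + 2 * K) * G ^ 2 * L := by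
  have ha := contDiff_re hu.1
  have hb := contDiff_im hu.1
  have ha₀ := contDiff_re hg
  have hb₀ := contDiff_im hg
  have hwa := ha.sub ha₀
  have hwb := hb.sub hb₀
  have hc := hD.cpos
  have hK : 0 ≤ K := (norm_nonneg _).trans (hD.curvature_le 0)
  have hM : 0 ≤ M := (norm_nonneg _).trans (hD.norm_le 0)
  have hug : ∀ s, u (γ s) = g (γ s) := fun s => hbd _ (hD.mem_frontier s)
  have hW0 : ∀ s, W (u (γ s)) = 0 := fun s => by
    rw [hug]; exact hW.eq_zero (hgΓ _ (hD.mem_frontier s))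
  obtain ⟨d, hd, hdΩ⟩ := hasDiv_pohozaev_solution hW.smooth hu
  have fa := hD.flux_bounds ha ha₀ (fun s => by rw [hug]) hG₁
  have fb := hD.flux_bounds hb hb₀ (fun s => by rw [hug]) hG₂
  have hcW : Continuous fun z => W (u z) := hW.smooth.continuous.comp hu.1.continuous
  have hdint : ∫ z in Ω, d z = -(2 * (ε ^ 2)⁻¹ * ∫ z in Ω, W (u z)) := by
    rw [setIntegral_congr_fun hD.isOpen.measurableSet hdΩ, integral_neg, integral_const_mul]
  have hWint : 0 ≤ ∫ z in Ω, W (u z) := integral_nonneg fun z => hW.nonneg _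
  constructor
  · have h1 := hD.flux.le_integral hd (C := 2 * ((M / 2 + M ^ 2 / c) * G ^ 2)) fun s => by
      obtain ⟨p, hp, h, -⟩ := fa s
      obtain ⟨q, hq, h', -⟩ := fb s
      have : 0 ≤ c / 4 * p := by positivity
      have : 0 ≤ c / 4 * q := by positivity
      simp only [hW0]
      linarith
    rw [hdint] at h1
    have h2 : (ε ^ 2)⁻¹ * (∫ z in Ω, W (u z)) ≤ (M / 2 + M ^ 2 / c) * G ^ 2 * L := by linarith
    rwa [inv_mul_le_iff₀ (by positivity)] at h2
  · have hdet := (hasDiv_hessDet hwa).add (hasDiv_hessDet hwb)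
    have hA := (hd.const_mul (8 * K / c)).add (hdet.const_mul 1)
    have h1 := hD.flux.le_integral hA
      (C := 2 * (8 * K / c * (M / 2 + M ^ 2 / c) + 2 * K) * G ^ 2) fun s => by
      obtain ⟨p, hp, h, k⟩ := fa s
      obtain ⟨q, hq, h', k'⟩ := fb s
      have hA0 : 0 ≤ 8 * K / c := by positivity
      have m1 := mul_le_mul_of_nonneg_left h hA0
      have m2 := mul_le_mul_of_nonneg_left h' hA0
      have e : ∀ r : ℝ, 8 * K / c * (c / 4 * r - (M / 2 + M ^ 2 / c) * G ^ 2) =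
          2 * K * r - 8 * K / c * (M / 2 + M ^ 2 / c) * G ^ 2 := fun r => by
        field_simp
        ring
      rw [e] at m1 m2
      simp only [hW0]
      linarith
    rw [setIntegral_linear_combination hD.isBounded _ _ hd.continuous hdet.continuous,
      hdint] at h1
    have h2 : 0 ≤ 8 * K / c * (2 * (ε ^ 2)⁻¹ * ∫ z in Ω, W (u z)) := by positivity
    have cl : Continuous fun z => lapR (fun y => (u y).re - (g y).re) z ^ 2 +
        lapR (fun y => (u y).im - (g y).im) z ^ 2 := ((continuous_lapR hwa).pow 2).add ((continuous_lapR hwb).pow 2)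
    have h3 : (∫ z in Ω, (hessNormSq (fun y => (u y).re - (g y).re) z +
        hessNormSq (fun y => (u y).im - (g y).im) z)) =
        ∫ z in Ω, (1 * (lapR (fun y => (u y).re - (g y).re) z ^ 2 +
          lapR (fun y => (u y).im - (g y).im) z ^ 2) + -1 *
          (2 * (px (px fun y => (u y).re - (g y).re) z * py (py fun y => (u y).re - (g y).re) z -
            px (py fun y => (u y).re - (g y).re) z ^ 2) +
          2 * (px (px fun y => (u y).im - (g y).im) z * py (py fun y => (u y).im - (g y).im) z -
            px (py fun y => (u y).im - (g y).im) z ^ 2))) := by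
      congr 1
      ext z
      simp only [hessNormSq, lapR_eq]
      ring
    rw [h3, setIntegral_linear_combination hD.isBounded 1 (-1) cl hdet.continuous]
    linarith

end Estimates

lemma gradSq_eq {u : ℂ → ℂ} (hu : Differentiable ℝ u) (z : ℂ) :
    gradSq u z = gradNormSq (fun y => (u y).re) z + gradNormSq (fun y => (u y).im) z := by
  simp only [gradSq, gradNormSq, px, py, sq_norm_eq, fderiv_re hu, fderiv_im hu]
  ring

lemma gradNormSq_le {a a₀ : ℂ → ℝ} (ha : ContDiff ℝ (⊤ : ℕ∞) a) (ha₀ : ContDiff ℝ (⊤ : ℕ∞) a₀)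
    (z : ℂ) : gradNormSq a z ≤ 2 * gradNormSq (fun y => a y - a₀ y) z + 2 * gradNormSq a₀ z := by
  simp only [gradNormSq, px_sub ha ha₀, py_sub ha ha₀]
  linarith [sq_nonneg (px a z - 2 * px a₀ z), sq_nonneg (py a z - 2 * py a₀ z)]

section Solution

variable {Ω Γ : Set ℂ} {γ nv τ : ℝ → ℂ} {L c M K G B R₀ ε Cg Cd C₀ μ δ : ℝ} {W : ℂ → ℝ}
  {u g : ℂ → ℂ}

/-- Bound for `∫ |∇u|⁴` in terms of bounds for the potential energy and the second derivatives. -/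
lemma StarDomain.gradSq_sq_bound (hD : StarDomain Ω γ nv L c M K)
    (hW : PotentialHyp Γ W R₀) (hε : 0 < ε) (hu : SolvesGL W Ω ε u)
    (hbd : ∀ x ∈ frontier Ω, u x = g x) (hg : ContDiff ℝ (⊤ : ℕ∞) g)
    (hCg : 0 ≤ Cg) (hgrad : ∀ z, ‖z‖ ≤ R₀ → px W z ^ 2 + py W z ^ 2 ≤ Cg * W z)
    (huR : ∀ z ∈ Ω, ‖u z‖ ≤ R₀) (hB : ∀ z ∈ Ω, ‖u z - g z‖ ≤ B) {E Ch : ℝ}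
    (hE : (∫ z in Ω, W (u z)) ≤ ε ^ 2 * E)
    (hH : (∫ z in Ω, (hessNormSq (fun y => (u y).re - (g y).re) z +
        hessNormSq (fun y => (u y).im - (g y).im) z)) ≤
      (∫ z in Ω, (lapR (fun y => (u y).re - (g y).re) z ^ 2 +
        lapR (fun y => (u y).im - (g y).im) z ^ 2)) + Ch) :
    (∫ z in Ω, gradSq u z ^ 2) ≤
      16 * (16 * B ^ 2 * (2 * (Cg * E * (ε ^ 2)⁻¹) + 2 * (∫ z in Ω,
        (lapR (fun y => (g y).re) z ^ 2 + lapR (fun y => (g y).im) z ^ 2)) + Ch) +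
      ∫ z in Ω, (gradNormSq (fun y => (g y).re) z ^ 2 + gradNormSq (fun y => (g y).im) z ^ 2)) := by
  have ha := contDiff_re hu.1
  have hb := contDiff_im hu.1
  have ha₀ := contDiff_re hg
  have hb₀ := contDiff_im hg
  have hwa := ha.sub ha₀
  have hwb := hb.sub hb₀
  have hug : ∀ s, u (γ s) = g (γ s) := fun s => hbd _ (hD.mem_frontier s)
  have hcW : Continuous fun z => W (u z) := hW.smooth.continuous.comp hu.1.continuous
  have cla := continuous_lapR hwa
  have clb := continuous_lapR hwb
  have cla₀ := continuous_lapR ha₀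
  have clb₀ := continuous_lapR hb₀
  have cga := continuous_gradNormSq hwa
  have cgb := continuous_gradNormSq hwb
  have cga₀ := continuous_gradNormSq ha₀
  have cgb₀ := continuous_gradNormSq hb₀
  have cgu : Continuous (gradSq u) := by
    rw [show gradSq u = _ from funext (gradSq_eq (differentiable_of_smooth hu.1))]
    exact (continuous_gradNormSq ha).add (continuous_gradNormSq hb)
  have cl₀ : Continuous fun z => lapR (fun y => (g y).re) z ^ 2 + lapR (fun y => (g y).im) z ^ 2 :=
    by fun_prop
  have hlap : (∫ z in Ω, (lapR (fun y => (u y).re - (g y).re) z ^ 2 +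
        lapR (fun y => (u y).im - (g y).im) z ^ 2)) ≤
      ∫ z in Ω, (2 * Cg * ((ε ^ 2)⁻¹) ^ 2 * W (u z) + 2 *
        (lapR (fun y => (g y).re) z ^ 2 + lapR (fun y => (g y).im) z ^ 2)) := by
    refine setIntegral_mono_of_continuous hD.isOpen hD.isBounded (by fun_prop)
      ((continuous_const.mul hcW).add (continuous_const.mul cl₀)) fun z hz => ?_
    rw [lapR_sub ha ha₀, lapR_sub hb hb₀]
    obtain ⟨l1, l2⟩ := hu.components hz
    rw [← lapR_eq] at l1 l2
    have h1 : lapR (fun y => (u y).re) z ^ 2 + lapR (fun y => (u y).im) z ^ 2 ≤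
        Cg * ((ε ^ 2)⁻¹) ^ 2 * W (u z) := by
      rw [l1, l2]
      have := mul_le_mul_of_nonneg_left (hgrad _ (huR z hz)) (sq_nonneg ((ε ^ 2)⁻¹))
      linarith
    linarith [sq_nonneg (lapR (fun y => (u y).re) z + lapR (fun y => (g y).re) z),
      sq_nonneg (lapR (fun y => (u y).im) z + lapR (fun y => (g y).im) z)]
  rw [setIntegral_linear_combination hD.isBounded _ _ hcW cl₀] at hlap
  have hlap' : 2 * Cg * ((ε ^ 2)⁻¹) ^ 2 * (∫ z in Ω, W (u z)) ≤ 2 * (Cg * E * (ε ^ 2)⁻¹) := by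
    have h1 : 2 * Cg * ((ε ^ 2)⁻¹) ^ 2 * (∫ z in Ω, W (u z)) ≤
        2 * Cg * ((ε ^ 2)⁻¹) ^ 2 * (ε ^ 2 * E) := by gcongr
    refine h1.trans_eq ?_
    field_simp
  have hBa : ∀ z ∈ Ω, ((u z).re - (g z).re) ^ 2 ≤ B ^ 2 := fun z hz => by
    have := pow_le_pow_left₀ (norm_nonneg _) (hB z hz) 2
    rw [sq_norm_eq, Complex.sub_re, Complex.sub_im] at this
    linarith [sq_nonneg ((u z).im - (g z).im)]
  have hBb : ∀ z ∈ Ω, ((u z).im - (g z).im) ^ 2 ≤ B ^ 2 := fun z hz => by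
    have := pow_le_pow_left₀ (norm_nonneg _) (hB z hz) 2
    rw [sq_norm_eq, Complex.sub_re, Complex.sub_im] at this
    linarith [sq_nonneg ((u z).re - (g z).re)]
  have ga := hD.flux.gradient_four_bound hD.isOpen hD.isBounded hwa
    (fun s => by rw [hug, sub_self]) hBa
  have gb := hD.flux.gradient_four_bound hD.isOpen hD.isBounded hwb
    (fun s => by rw [hug, sub_self]) hBb
  have hHsplit : (∫ z in Ω, (hessNormSq (fun y => (u y).re - (g y).re) z +
      hessNormSq (fun y => (u y).im - (g y).im) z)) =
      (∫ z in Ω, hessNormSq (fun y => (u y).re - (g y).re) z) +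
      ∫ z in Ω, hessNormSq (fun y => (u y).im - (g y).im) z :=
    integral_add ((continuous_hessNormSq hwa).integrableOn_of_isBounded hD.isBounded)
      ((continuous_hessNormSq hwb).integrableOn_of_isBounded hD.isBounded)
  have c1 : Continuous fun z => gradNormSq (fun y => (u y).re - (g y).re) z ^ 2 := cga.pow 2
  have c2 : Continuous fun z => gradNormSq (fun y => (u y).im - (g y).im) z ^ 2 := cgb.pow 2
  have c12 : Continuous fun z => 1 * gradNormSq (fun y => (u y).re - (g y).re) z ^ 2 +
      1 * gradNormSq (fun y => (u y).im - (g y).im) z ^ 2 := by fun_prop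
  have c₀ : Continuous fun z => gradNormSq (fun y => (g y).re) z ^ 2 +
      gradNormSq (fun y => (g y).im) z ^ 2 := by fun_prop
  have hfin : (∫ z in Ω, gradSq u z ^ 2) ≤
      ∫ z in Ω, (16 * (1 * gradNormSq (fun y => (u y).re - (g y).re) z ^ 2 +
        1 * gradNormSq (fun y => (u y).im - (g y).im) z ^ 2) +
      16 * (gradNormSq (fun y => (g y).re) z ^ 2 + gradNormSq (fun y => (g y).im) z ^ 2)) := by
    refine setIntegral_mono_of_continuous hD.isOpen hD.isBounded (by fun_prop) (by fun_prop)
      fun z hz => ?_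
    rw [gradSq_eq (differentiable_of_smooth hu.1)]
    have p1 := gradNormSq_le ha ha₀ z
    have p2 := gradNormSq_le hb hb₀ z
    have q1 : 0 ≤ gradNormSq (fun y => (u y).re) z + gradNormSq (fun y => (u y).im) z := by
      unfold gradNormSq; positivity
    have q2 := pow_le_pow_left₀ q1 (add_le_add p1 p2) 2
    generalize gradNormSq (fun y => (u y).re - (g y).re) z = x₁ at *
    generalize gradNormSq (fun y => (u y).im - (g y).im) z = x₂ at *
    generalize gradNormSq (fun y => (g y).re) z = x₃ at *
    generalize gradNormSq (fun y => (g y).im) z = x₄ at *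
    linarith [sq_nonneg (x₁ - x₂), sq_nonneg (x₁ - x₃), sq_nonneg (x₁ - x₄), sq_nonneg (x₂ - x₃),
      sq_nonneg (x₂ - x₄), sq_nonneg (x₃ - x₄)]
  rw [setIntegral_linear_combination hD.isBounded 16 16 c12 c₀,
    setIntegral_linear_combination hD.isBounded 1 1 c1 c2] at hfin
  have hlast := mul_le_mul_of_nonneg_left (hH.trans (add_le_add_left (hlap.trans
    (add_le_add_left hlap' _)) _)) (by positivity : 0 ≤ 16 * B ^ 2)
  rw [hHsplit] at hlast
  linarith

/-- Bound for the Dirichlet integral of a normal gradient. -/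
lemma StarDomain.normalGradient_bound (hD : StarDomain Ω γ nv L c M K) (hΓ : ArcParam Γ τ)
    (hW : PotentialHyp Γ W R₀) (hε : 0 < ε) (hu : SolvesGL W Ω ε u)
    (hbd : ∀ x ∈ frontier Ω, u x ∈ Γ) (huR : ∀ z ∈ Ω, ‖u z‖ ≤ R₀)
    (hμ : 0 < μ) (hδ : 0 < δ) (hnd : ∀ z : ℂ, infDist z Γ < δ → μ * infDist z Γ ^ 2 ≤ W z)
    (hC₀ : 0 ≤ C₀)
    (hlip : ∀ z ∈ closedBall (0 : ℂ) R₀, ∀ p ∈ closedBall (0 : ℂ) R₀, ∀ v,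
      hess W p v - C₀ * ‖z - p‖ * ‖v‖ ^ 2 ≤ hess W z v)
    (hCd : 0 ≤ Cd) (hdist : ∀ z, ‖z‖ ≤ R₀ → infDist z Γ ^ 2 ≤ Cd * W z)
    {E α β : ℝ} (hα : 0 ≤ α) (hβ : 0 ≤ β) (hE : (∫ z in Ω, W (u z)) ≤ ε ^ 2 * E)
    (h4 : (∫ z in Ω, gradSq u z ^ 2) ≤ α + β * (ε ^ 2)⁻¹)
    {h : ℂ → ℝ} (hh : ∀ x, IsNormalGradient Γ u h x) :
    (∫ z in Ω, ‖fderiv ℝ h z‖ ^ 2) ≤ C₀ / (2 * μ) *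
      (1 / 2 * ((2 * R₀) ^ 2 * (∫ _ in Ω, (1 : ℝ)) + Cd * E + (α + β))) := by
  have hd := hasDiv_gradComp hW.smooth hu.1
  have ha := contDiff_re hu.1
  have hb := contDiff_im hu.1
  have hcu := hu.1.continuous
  have hcW : Continuous fun z => W (u z) := hW.smooth.continuous.comp hcu
  have cD : Continuous fun z => infDist (u z) Γ := (continuous_infDist_pt Γ).comp hcu
  have cgu : Continuous (gradSq u) := by
    rw [show gradSq u = _ from funext (gradSq_eq (differentiable_of_smooth hu.1))]
    exact (continuous_gradNormSq ha).add (continuous_gradNormSq hb)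
  have ch : ∀ v, Continuous fun z => hess W (u z) (fderiv ℝ u z v) := fun v => by
    have cv : Continuous fun z => fderiv ℝ u z v :=
      (differentiable_fderiv_apply hu.1 v).continuous
    have k11 := (contDiff_px (contDiff_px hW.smooth)).continuous
    have k12 := (contDiff_px (contDiff_py hW.smooth)).continuous
    have k22 := (contDiff_py (contDiff_py hW.smooth)).continuous
    unfold hess
    fun_prop
  have ch1 := ch 1
  have chI := ch I
  have cH : Continuous fun z => hess W (u z) (fderiv ℝ u z 1) + hess W (u z) (fderiv ℝ u z I) :=
    ch1.add chI
  have hgz : ∀ s, px W (u (γ s)) = 0 ∧ py W (u (γ s)) = 0 := fun s =>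
    hW.grad_eq_zero (hbd _ (hD.mem_frontier s))
  have hHint : (∫ z in Ω, (hess W (u z) (fderiv ℝ u z 1) + hess W (u z) (fderiv ℝ u z I))) ≤ 0 := by
    refine (setIntegral_mono_of_continuous hD.isOpen hD.isBounded cH hd.continuous
      fun z hz => ?_).trans (hD.flux.integral_nonpos hd (fun s => by simp [hgz s])
        fun s => by simp [hgz s])
    obtain ⟨l1, l2⟩ := hu.components hz
    rw [l1, l2]
    have : 0 ≤ (ε ^ 2)⁻¹ * (px W (u z) ^ 2 + py W (u z) ^ 2) := by positivity
    linarith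
  have ht : 0 < (ε ^ 2)⁻¹ := by positivity
  have cD2 : Continuous fun z => infDist (u z) Γ ^ 2 := cD.pow 2
  have cg2 : Continuous fun z => gradSq u z ^ 2 := cgu.pow 2
  have cDg : Continuous fun z => infDist (u z) Γ * gradSq u z := cD.mul cgu
  have hD1 : (∫ z in Ω, infDist (u z) Γ ^ 2) ≤ (2 * R₀) ^ 2 * ∫ _ in Ω, (1 : ℝ) := by
    rw [← integral_const_mul]
    refine setIntegral_mono_of_continuous hD.isOpen hD.isBounded cD2 continuous_const
      fun z hz => ?_
    obtain ⟨p, hp⟩ := hΓ.nonempty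
    have h1 : infDist (u z) Γ ≤ 2 * R₀ := by
      refine (infDist_le_dist_of_mem hp).trans ?_
      rw [dist_eq_norm]
      linarith [norm_sub_le (u z) p, huR z hz, hW.R0_large p hp]
    have := pow_le_pow_left₀ infDist_nonneg h1 2
    linarith
  have hD2 : (∫ z in Ω, infDist (u z) Γ ^ 2) ≤ ε ^ 2 * (Cd * E) := by
    have h1 : (∫ z in Ω, infDist (u z) Γ ^ 2) ≤ ∫ z in Ω, Cd * W (u z) :=
      setIntegral_mono_of_continuous hD.isOpen hD.isBounded cD2
        (continuous_const.mul hcW) fun z hz => hdist _ (huR z hz)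
    have h2 := mul_le_mul_of_nonneg_left hE hCd
    rw [integral_const_mul] at h1
    linarith
  have hD3 : (1 + (ε ^ 2)⁻¹) * (∫ z in Ω, infDist (u z) Γ ^ 2) ≤
      (2 * R₀) ^ 2 * (∫ _ in Ω, (1 : ℝ)) + Cd * E := by
    have h1 := mul_le_mul_of_nonneg_left hD2 ht.le
    rw [inv_mul_cancel_left₀ (by positivity)] at h1
    linarith
  have h4' : (1 + (ε ^ 2)⁻¹)⁻¹ * (∫ z in Ω, gradSq u z ^ 2) ≤ α + β := by
    rw [inv_mul_le_iff₀ (by positivity)]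
    have : 0 ≤ α * (ε ^ 2)⁻¹ := by positivity
    linarith
  have hDg : (∫ z in Ω, infDist (u z) Γ * gradSq u z) ≤
      1 / 2 * ((2 * R₀) ^ 2 * (∫ _ in Ω, (1 : ℝ)) + Cd * E + (α + β)) := by
    have h1 : (∫ z in Ω, infDist (u z) Γ * gradSq u z) ≤
        ∫ z in Ω, (1 / 2 * (1 + (ε ^ 2)⁻¹) * infDist (u z) Γ ^ 2 +
          1 / 2 * (1 + (ε ^ 2)⁻¹)⁻¹ * gradSq u z ^ 2) := by
      refine setIntegral_mono_of_continuous hD.isOpen hD.isBounded cDg (by fun_prop)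
        fun z hz => ?_
      have hl : 0 < 1 + (ε ^ 2)⁻¹ := by positivity
      generalize 1 + (ε ^ 2)⁻¹ = l at *
      generalize infDist (u z) Γ = x
      generalize gradSq u z = y
      have e : 1 / 2 * l * x ^ 2 + 1 / 2 * l⁻¹ * y ^ 2 - x * y = 1 / 2 * l⁻¹ * (l * x - y) ^ 2 := by
        field_simp
        ring
      have : 0 ≤ 1 / 2 * l⁻¹ * (l * x - y) ^ 2 := by positivity
      linarith
    rw [setIntegral_linear_combination hD.isBounded _ _ cD2 cg2] at h1
    linarith
  have hpt : (∫ z in Ω, ‖fderiv ℝ h z‖ ^ 2) ≤ ∫ z in Ω, (1 / (2 * μ) *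
      (hess W (u z) (fderiv ℝ u z 1) + hess W (u z) (fderiv ℝ u z I)) +
        C₀ / (2 * μ) * (infDist (u z) Γ * gradSq u z)) := by
    refine integral_mono_of_nonneg (Eventually.of_forall fun z => sq_nonneg _)
      (Continuous.integrableOn_of_isBounded hD.isBounded (by fun_prop)) ?_
    filter_upwards [ae_restrict_mem hD.isOpen.measurableSet] with z hz
    have h1 := hW.normalGradient_le hΓ hδ hμ hnd hlip (hh z) (huR z hz)
    rw [div_mul_eq_mul_div, div_mul_eq_mul_div, ← add_div, le_div_iff₀ (by positivity)]
    linarith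
  rw [setIntegral_linear_combination hD.isBounded _ _ cH cDg] at hpt
  have h1 : 1 / (2 * μ) * (∫ z in Ω, (hess W (u z) (fderiv ℝ u z 1) +
      hess W (u z) (fderiv ℝ u z I))) ≤ 0 :=
    mul_nonpos_of_nonneg_of_nonpos (by positivity) hHint
  have h2 := mul_le_mul_of_nonneg_left hDg (by positivity : 0 ≤ C₀ / (2 * μ))
  linarith

end Solution

/-- A continuous function is bounded along a periodic curve. -/
lemma exists_bound_of_periodic {f : ℝ → ℝ} (hf : Continuous f) {L : ℝ} (hL : 0 < L)
    (hp : Function.Periodic f L) : ∃ C, ∀ s, f s ≤ C := by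
  obtain ⟨C, hC⟩ := isCompact_Icc.bddAbove_image (hf.continuousOn (s := Icc 0 (0 + L)))
  refine ⟨C, fun s => hC ?_⟩
  rw [hp.image_Icc hL 0]
  exact mem_range_self s

/-- Uniform bound for normal gradients of solutions on strictly star-shaped domains. -/
theorem exists_normalGradient_bound {Γ Ω : Set ℂ} {τ γ nv : ℝ → ℂ} {W : ℂ → ℝ} {R₀ L c : ℝ}
    (hΓ : ArcParam Γ τ) (hW : PotentialHyp Γ W R₀) (hΩo : IsOpen Ω) (hΩb : IsBounded Ω)
    (h0 : (0 : ℂ) ∈ Ω) (hγ : BoundaryParam Ω γ L) (hn : OutwardNormal Ω γ nv) (hc : 0 < c)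
    (hstar : ∀ s, c ≤ (γ s).re * (nv s).re + (γ s).im * (nv s).im)
    {g : ℂ → ℂ} (hg : ContDiff ℝ (⊤ : ℕ∞) g) (hgΓ : ∀ x ∈ frontier Ω, g x ∈ Γ) :
    ∃ C : ℝ, ∀ ε > (0 : ℝ), ∀ u : ℂ → ℂ, SolvesGL W Ω ε u → (∀ x ∈ frontier Ω, u x = g x) →
      ∀ h : ℂ → ℝ, (∀ x, IsNormalGradient Γ u h x) → (∫ z in Ω, ‖fderiv ℝ h z‖ ^ 2) ≤ C := by
  have hγ2 : ContDiff ℝ (1 + 1) γ := by exact_mod_cast contDiff_infty.1 hγ.smooth 2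
  have hγ1 : ContDiff ℝ 1 (deriv γ) := (contDiff_succ_iff_deriv.1 hγ2).2.2
  have cγ := hγ.smooth.continuous
  have hper : ∀ f : ℝ → ℂ, Function.Periodic f L → Function.Periodic (deriv f) L := fun f hf s => by
    rw [← deriv_comp_add_const, funext hf]
  have hfr : ∀ s, γ s ∈ frontier Ω := fun s => by rw [← hγ.srange]; exact mem_range_self s
  obtain ⟨M, hM⟩ := exists_bound_of_periodic cγ.norm hγ.Lpos fun s => by rw [hγ.periodic]
  obtain ⟨K, hK⟩ := exists_bound_of_periodic (hγ1.continuous_deriv le_rfl).norm hγ.Lpos fun s => by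
    rw [hper _ (hper _ hγ.periodic)]
  obtain ⟨G₁, hG₁⟩ := exists_bound_of_periodic
    ((continuous_gradNormSq (contDiff_re hg)).comp cγ) hγ.Lpos fun s => by
      simp only [Function.comp, hγ.periodic s]
  obtain ⟨G₂, hG₂⟩ := exists_bound_of_periodic
    ((continuous_gradNormSq (contDiff_im hg)).comp cγ) hγ.Lpos fun s => by
      simp only [Function.comp, hγ.periodic s]
  have hD : StarDomain Ω γ nv L c M K :=
    ⟨hΩo, hΩb, fluxBound_of_starShaped hΩo hΩb h0 hγ hn.unit hn.orth hc hstar, hγ.smooth, hfr,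
      hn.unit, hγ.arclength, hn.orth, hc, hstar, hM, hK⟩
  have hK0 : 0 ≤ K := (norm_nonneg _).trans (hK 0)
  have hM0 : 0 ≤ M := (norm_nonneg _).trans (hM 0)
  have hL := hγ.Lpos
  obtain ⟨p, hp⟩ := hΓ.nonempty
  have hR₀ : 0 ≤ R₀ := (norm_nonneg p).trans (hW.R0_large p hp).le
  obtain ⟨μ, hμ, δ, hδ, hnd⟩ := hW.nondeg
  obtain ⟨C₀, hC₀, hlip⟩ := exists_hess_lipschitz hW.smooth R₀
  obtain ⟨Cg, hCg, hgrad⟩ := hW.exists_grad_bound hΓ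
  obtain ⟨Cd, hCd, hdist⟩ := hW.exists_dist_bound
  obtain ⟨B₀, hB₀⟩ := hΩb.isCompact_closure.exists_bound_of_continuousOn hg.continuous.continuousOn
  set B := R₀ + B₀ with hBdef
  set G := √(max (max G₁ G₂) 0) with hGdef
  have hG2 : G ^ 2 = max (max G₁ G₂) 0 := Real.sq_sqrt (le_max_right _ _)
  set E := (M / 2 + M ^ 2 / c) * G ^ 2 * L with hEdef
  set Ch := 2 * (8 * K / c * (M / 2 + M ^ 2 / c) + 2 * K) * G ^ 2 * L with hChdef
  set E₁ := ∫ z in Ω, (lapR (fun y => (g y).re) z ^ 2 + lapR (fun y => (g y).im) z ^ 2) with hE₁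
  set E₂ := ∫ z in Ω, (gradNormSq (fun y => (g y).re) z ^ 2 + gradNormSq (fun y => (g y).im) z ^ 2)
    with hE₂
  have hE0 : 0 ≤ E := by positivity
  have hCh0 : 0 ≤ Ch := by positivity
  have hE₁0 : 0 ≤ E₁ := integral_nonneg fun z => by positivity
  have hE₂0 : 0 ≤ E₂ := integral_nonneg fun z => by positivity
  refine ⟨C₀ / (2 * μ) * (1 / 2 * ((2 * R₀) ^ 2 * (∫ _ in Ω, (1 : ℝ)) + Cd * E +
    (16 * (16 * B ^ 2 * (2 * E₁ + Ch) + E₂) + 512 * B ^ 2 * (Cg * Cd * E)))),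
    fun ε hε u hu hbd h hh => ?_⟩
  have hbdΓ : ∀ x ∈ frontier Ω, u x ∈ Γ := fun x hx => by rw [hbd x hx]; exact hgΓ x hx
  have huR : ∀ z ∈ Ω, ‖u z‖ ≤ R₀ := fun z hz =>
    norm_le_of_solvesGL hW hR₀ hΩo hΩb hε hu hbdΓ hz
  obtain ⟨hE, hH⟩ := hD.energy_and_hessian_bound (G := G) hW hε hu hbd hg hgΓ
    (fun s => by rw [hG2]; exact (hG₁ s).trans ((le_max_left _ _).trans (le_max_left _ _)))
    (fun s => by rw [hG2]; exact (hG₂ s).trans ((le_max_right _ _).trans (le_max_left _ _)))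
  have hgradW : ∀ z, ‖z‖ ≤ R₀ → px W z ^ 2 + py W z ^ 2 ≤ Cg * Cd * W z := fun z hz => by
    have := mul_le_mul_of_nonneg_left (hdist z hz) hCg
    linarith [hgrad z hz]
  have h4 := hD.gradSq_sq_bound hW hε hu hbd hg (by positivity) hgradW huR
    (B := B) (fun z hz => (norm_sub_le _ _).trans
      (add_le_add (huR z hz) (hB₀ z (subset_closure hz)))) hE hH
  refine hD.normalGradient_bound hΓ hW hε hu hbdΓ huR hμ hδ hnd hC₀ hlip hCd hdist
    (by positivity) (by positivity) hE ?_ hh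
  rw [← hE₁, ← hE₂] at h4
  refine h4.trans (le_of_eq ?_)
  ring

/-- Proposition 5.3 and Corollary 5.5: for solutions on a smooth bounded
strictly star-shaped domain with smooth `Γ`-valued boundary datum,
`∫_Ω |∇(dist(u_ε,Γ))|² ≤ C` uniformly in `ε`; in particular, in the Ginzburg–Landau case
`W(u) = (1-|u|²)²/4`, one has `∫_Ω |∇|u_ε||² ≤ C` uniformly in `ε`. -/
theorem dist_gradient_L2_bound
    (Γ : Set ℂ) (τ : ℝ → ℂ) (W : ℂ → ℝ) (R₀ : ℝ)
    (hΓ : ArcParam Γ τ) (hW : PotentialHyp Γ W R₀)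
    (Ω : Set ℂ) (hΩo : IsOpen Ω) (hΩb : Bornology.IsBounded Ω) (h0 : (0 : ℂ) ∈ Ω)
    (γ : ℝ → ℂ) (L : ℝ) (hγ : BoundaryParam Ω γ L)
    (nv : ℝ → ℂ) (hn : OutwardNormal Ω γ nv)
    (c : ℝ) (hc : 0 < c)
    (hstar : ∀ s, c ≤ (γ s).re * (nv s).re + (γ s).im * (nv s).im)
    (g : ℂ → ℂ) (hg : ContDiff ℝ (⊤ : ℕ∞) g) (hgΓ : ∀ x ∈ frontier Ω, g x ∈ Γ)
    (u : ℝ → ℂ → ℂ)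
    (hu : ∀ ε > (0 : ℝ), SolvesGL W Ω ε (u ε) ∧ ∀ x ∈ frontier Ω, u ε x = g x)
    :
    (∃ C : ℝ, ∀ ε > (0 : ℝ),
        (∫ y in Ω, ‖fderiv ℝ (fun w => Metric.infDist (u ε w) Γ) y‖ ^ 2) ≤ C) ∧
    ((∀ z : ℂ, W z = (1 - ‖z‖ ^ 2) ^ 2 / 4) →
      ∃ C : ℝ, ∀ ε > (0 : ℝ),
        (∫ y in Ω, ‖fderiv ℝ (fun w => ‖u ε w‖) y‖ ^ 2) ≤ C) := by
  obtain ⟨C, hC⟩ := exists_normalGradient_bound hΓ hW hΩo hΩb h0 hγ hn hc hstar hg hgΓ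
  refine ⟨⟨C, fun ε hε => hC ε hε (u ε) (hu ε hε).1 (hu ε hε).2 _ fun x =>
      isNormalGradient_infDist hΓ (differentiable_of_smooth (hu ε hε).1.1) x⟩,
    fun hGL => ⟨C, fun ε hε => hC ε hε (u ε) (hu ε hε).1 (hu ε hε).2 _ fun x =>
      isNormalGradient_norm ?_ (differentiable_of_smooth (hu ε hε).1.1) x⟩⟩
  ext z
  rw [← hW.zeros, mem_preimage, mem_singleton_iff, hGL, mem_sphere_zero_iff_norm]
  constructor
  · intro h
    have h1 : (1 - ‖z‖) * (1 + ‖z‖) = 0 := by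
      have : (1 - ‖z‖ ^ 2) = 0 := by simpa using h
      linarith
    rcases mul_eq_zero.1 h1 with h2 | h2 <;> linarith [norm_nonneg z]
  · intro h
    norm_num [h]
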